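/- Let φ: X ⇢ Y be a birational rational map between smooth projective n-dimensional varieties over ℂ, both with trivial canonical line bundle, and let U ⊂ X be the maximal Zariski open dense subset on which φ extends to a regular morphism φ_0: U → Y. Then φ_0 is étale, and moreover φ_0 is an open immersion of U onto the maximal open subset V ⊂ Y on which φ^{-1} is defined. -/

import Mathlib

/-!
STATEMENT 12: Let φ: X ⇢ Y be a birational rational map between smooth projective
n-dimensional varieties over ℂ, both with trivial canonical line bundle, and let
U ⊂ X be the maximal Zariski open dense subset on which φ extends to a regular
morphism φ₀ : U → Y. Then φ₀ is étale, and moreover φ₀ is an open immersion of U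
onto the maximal open subset V ⊂ Y on which φ⁻¹ is defined.
-/

open AlgebraicGeometry CategoryTheory Opposite

universe u

attribute [local instance] MvPolynomial.gradedAlgebra

noncomputable section

namespace BirGeo

/-- Transfer of (exterior-algebra valued) differential forms along a morphism of
`R`-algebras `A → B`: the natural map `⋀ Ω[A⁄R] → ⋀ Ω[B⁄R]` induced by
functoriality of Kähler differentials. -/
noncomputable def formTransfer (R A B : Type u) [CommRing R] [CommRing A] [CommRing B]
    [Algebra R A] [Algebra R B] [Algebra A B] [IsScalarTower R A B] :
    ExteriorAlgebra A (Ω[A⁄R]) → ExteriorAlgebra B (Ω[B⁄R]) :=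
  letI : Algebra A (ExteriorAlgebra B (Ω[B⁄R])) :=
    Algebra.compHom (ExteriorAlgebra B (Ω[B⁄R])) (algebraMap A B)
  letI : IsScalarTower A B (ExteriorAlgebra B (Ω[B⁄R])) :=
    IsScalarTower.of_algebraMap_eq' rfl
  fun w =>
    ExteriorAlgebra.lift A
      ⟨(@LinearMap.restrictScalars A B (Ω[B⁄R]) (ExteriorAlgebra B (Ω[B⁄R])) _ _ _ _ _ _ _ _
          ⟨fun f c x => by rw [← algebraMap_smul B c x, map_smul]; rfl⟩
          (ExteriorAlgebra.ι B (M := Ω[B⁄R]))).comp (KaehlerDifferential.map R R A B),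
        fun m => by
          simp [ExteriorAlgebra.ι_sq_zero (R := B) ((KaehlerDifferential.map R R A B) m)]⟩ w

variable (k : CommRingCat.{u}) (X : Scheme.{u}) [X.Over (Spec k)]

/-- The canonical ring homomorphism from the base ring `k` to the ring of sections
over an open `U` of a scheme `X` over `Spec k`. -/
noncomputable def secHom (U : X.Opens) : ↥k →+* ↥Γ(X, U) :=
  ((Scheme.ΓSpecIso k).inv ≫ (X ↘ Spec k).appTop ≫ X.presheaf.map (homOfLE le_top).op : _ ⟶ _).hom

/-- The `k`-algebra structure on sections of a scheme over `Spec k`. -/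
noncomputable def secAlgebra (U : X.Opens) : Algebra ↥k ↥Γ(X, U) :=
  (secHom k X U).toAlgebra

/-- Algebraic differential forms on an open `U` of a scheme `X` over `Spec k`:
the exterior algebra of the module of Kähler differentials of `Γ(X, U)` over `k`. -/
noncomputable def FormsOn (U : X.Opens) : Type u :=
  letI := secAlgebra k X U
  ExteriorAlgebra ↥Γ(X, U) (Ω[↥Γ(X, U)⁄↥k])

/-- `w` is a differential form of degree `n` on `U`, i.e. lies in the `n`-th
exterior power of the Kähler differentials. -/
noncomputable def FormsOn.IsDegree (n : ℕ) (U : X.Opens) (w : FormsOn k X U) : Prop :=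
  letI := secAlgebra k X U
  w ∈ ⋀[↥Γ(X, U)]^n (Ω[↥Γ(X, U)⁄↥k])

/-- The degree `n` form `w` on `U` generates the module of degree `n` forms on `U`
(equivalently, the section `w` of the line bundle `Ω^n` trivializes it over `U`,
i.e. has no zeros on `U`). -/
noncomputable def FormsOn.Generates (n : ℕ) (U : X.Opens) (w : FormsOn k X U) : Prop :=
  letI := secAlgebra k X U
  let w' : ExteriorAlgebra ↥Γ(X, U) (Ω[↥Γ(X, U)⁄↥k]) := w
  (⋀[↥Γ(X, U)]^n (Ω[↥Γ(X, U)⁄↥k]) : Submodule ↥Γ(X, U) _) ≤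
    Submodule.span ↥Γ(X, U) {w'}

variable {X} in
/-- Pullback of differential forms along a morphism `g : Z ⟶ X` of schemes over
`Spec k`, from an open `U ⊆ X` to an open `W ⊆ Z` with `W ≤ g⁻¹(U)`.
Taking `g = 𝟙 X` gives restriction of forms to smaller opens. -/
noncomputable def formPullback {Z : Scheme.{u}} [Z.Over (Spec k)]
    (g : Z ⟶ X) (hg : g ≫ (X ↘ Spec k) = Z ↘ Spec k)
    (U : X.Opens) (W : Z.Opens) (e : W ≤ g ⁻¹ᵁ U) :
    FormsOn k X U → FormsOn k Z W :=
  letI := secAlgebra k X U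
  letI := secAlgebra k Z W
  letI : Algebra ↥Γ(X, U) ↥Γ(Z, W) := RingHom.toAlgebra (g.appLE U W e : Γ(X, U) ⟶ Γ(Z, W)).hom
  letI : IsScalarTower ↥k ↥Γ(X, U) ↥Γ(Z, W) := IsScalarTower.of_algebraMap_eq' (by
    show secHom k Z W = RingHom.comp (g.appLE U W e : Γ(X, U) ⟶ Γ(Z, W)).hom (secHom k X U)
    have h : ((Scheme.ΓSpecIso k).inv ≫ (Z ↘ Spec k).appTop ≫
          Z.presheaf.map (homOfLE le_top).op : k ⟶ Γ(Z, W))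
        = (Scheme.ΓSpecIso k).inv ≫ (X ↘ Spec k).appTop ≫
          X.presheaf.map (homOfLE le_top).op ≫ g.appLE U W e := by
      rw [← hg]
      simp only [Scheme.Hom.comp_appTop, Category.assoc, Scheme.Hom.map_appLE]
      rfl
    exact congrArg CommRingCat.Hom.hom h)
  formTransfer ↥k ↥Γ(X, U) ↥Γ(Z, W)

/-- A gauge form of degree `n` on a scheme `X` over `Spec k`: a nowhere vanishing
global section of the sheaf `Ω^n_{X/k}` of degree `n` differential forms, given as a
compatible family of degree `n` forms on all affine opens, generating the sheaf of
degree `n` forms everywhere. The canonical line bundle `Ω^n_X` of a smooth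
`n`-dimensional `X` is trivial if and only if a gauge form of degree `n` exists. -/
structure GaugeForm (n : ℕ) : Type u where
  form : ∀ U : X.Opens, IsAffineOpen U → FormsOn k X U
  isDegree : ∀ U hU, FormsOn.IsDegree k X n U (form U hU)
  compat : ∀ (U V : X.Opens) (hU : IsAffineOpen U) (hV : IsAffineOpen V) (e : V ≤ U),
    formPullback k (𝟙 X) (Category.id_comp _) U V (by simpa using e) (form U hU) = form V hV
  generates : ∀ U hU, FormsOn.Generates k X n U (form U hU)

/-- Complex projective space `ℙ^N` as a scheme: `Proj ℂ[x_0, …, x_N]`. -/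
noncomputable def ComplexProjSpace (N : ℕ) : Scheme :=
  Proj (MvPolynomial.homogeneousSubmodule (Fin (N + 1)) ℂ)

/-- A scheme is projective (over `ℂ`) if it admits a closed immersion into some
complex projective space. -/
def IsProjectiveComplexVariety (X : Scheme) : Prop :=
  ∃ (N : ℕ) (i : X ⟶ ComplexProjSpace N), IsClosedImmersion i

end BirGeo

end

open BirGeo

local notation "ℂRing" => CommRingCat.of ℂ

namespace BG
open TensorProduct

theorem normal_of_etale (P B : Type) [CommRing P] [CommRing B] [Algebra P B] [IsDomain P]
    [IsIntegrallyClosed P] [IsDomain B] [Algebra.Etale P B] : IsIntegrallyClosed B := by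
  let Q := FractionRing P
  let T := Q ⊗[P] B
  have hfl : Module.Flat P B := inferInstance
  have hinj : Function.Injective (algebraMap P B) := FaithfulSMul.algebraMap_injective P B
  let : Algebra B T := Algebra.TensorProduct.rightAlgebra
  have hloc : IsLocalization (Algebra.algebraMapSubmonoid B (nonZeroDivisors P)) T :=
    inferInstance
  have hle : Algebra.algebraMapSubmonoid B (nonZeroDivisors P) ≤ nonZeroDivisors B := by
    rintro _ ⟨p, hp, rfl⟩
    have hp : p ∈ nonZeroDivisors P := hp
    rw [mem_nonZeroDivisors_iff_ne_zero] at hp ⊢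
    simpa using hp
  have : IsDomain T := IsLocalization.isDomain_of_le_nonZeroDivisors T hle
  have : Algebra.Etale Q T := inferInstance
  have := Algebra.FormallyUnramified.finite_of_free Q T
  have hf : IsField T := isField_of_isIntegral_of_isField' (Field.toIsField Q)
  let := hf.toField
  have : FaithfulSMul B T := (faithfulSMul_iff_algebraMap_injective B T).mpr
    (IsLocalization.injective T hle)
  have : IsFractionRing B T := by
    apply IsFractionRing.of_field
    intro z
    obtain ⟨x, y, rfl⟩ := IsLocalization.exists_mk'_eq
      (Algebra.algebraMapSubmonoid B (nonZeroDivisors P)) z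
    have hy : (y : B) ≠ 0 := nonZeroDivisors.ne_zero (hle y.2)
    refine ⟨x, y, ?_⟩
    rw [eq_div_iff (by simpa using hy), IsLocalization.mk'_spec]
  rw [isIntegrallyClosed_iff T]
  intro x hx
  let e : T ≃ₐ[P] B ⊗[P] Q := Algebra.TensorProduct.comm P Q B
  have he : ∀ b, e (algebraMap B T b) = b ⊗ₜ 1 := fun b => by
    exact Algebra.TensorProduct.comm_tmul ..
  have hx' : IsIntegral B (e x) := by
    let e' : T →ₐ[B] B ⊗[P] Q := {e.toRingHom with commutes' := he}
    exact hx.map e'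
  obtain ⟨z, hz⟩ := (TensorProduct.toIntegralClosure_bijective_of_smooth (R := P) (S := B) (B := Q)).2 ⟨e x, hx'⟩
  have hz' := congrArg Subtype.val hz
  suffices h : ∃ y : B, y ⊗ₜ 1 = (TensorProduct.toIntegralClosure P B Q z).1 by
    obtain ⟨y, hy⟩ := h
    exact ⟨y, e.injective (by rw [he, hy, hz'])⟩
  clear hz' hz hx' hx
  induction z with
  | zero => exact ⟨0, by simp⟩
  | add x y h1 h2 =>
    obtain ⟨a, ha⟩ := h1
    obtain ⟨b, hb⟩ := h2
    exact ⟨a + b, by simp [ha, hb, add_tmul]⟩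
  | tmul b q =>
    obtain ⟨p, hp⟩ := IsIntegrallyClosed.isIntegral_iff.mp q.2
    refine ⟨p • b, ?_⟩
    change _ = b ⊗ₜ[P] (q : Q)
    rw [← hp, TensorProduct.smul_tmul, Algebra.algebraMap_eq_smul_one]

theorem normal_of_smooth (k B : Type) [Field k] [CommRing B] [Algebra k B]
    [IsDomain B] [Algebra.IsStandardSmooth k B] : IsIntegrallyClosed B := by
  obtain ⟨n, g, h1, h2⟩ := RingHom.IsStandardSmooth.exists_etale_mvPolynomial
    (f := algebraMap k B) (by simpa [RingHom.isStandardSmooth_algebraMap])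
  algebraize [g]
  exact normal_of_etale (MvPolynomial (Fin n) k) B
end BG

namespace BG
theorem dvr_of_mul (R K : Type) [CommRing R] [IsDomain R] [IsNoetherianRing R] [IsLocalRing R]
    [IsIntegrallyClosed R] [Field K] [Algebra R K] [IsFractionRing R K] (g : K)
    (hg : g ∉ (algebraMap R K).range)
    (h : ∀ m ∈ IsLocalRing.maximalIdeal R, algebraMap R K m * g ∈ (algebraMap R K).range)
    (hne : IsLocalRing.maximalIdeal R ≠ ⊥) :
    IsDiscreteValuationRing R := by
  have hnf : ¬ IsField R := by rwa [IsLocalRing.isField_iff_maximalIdeal_eq]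
  have tf := (IsDiscreteValuationRing.TFAE R hnf).out 0 4
  rw [tf]
  by_cases hx : ∀ m ∈ IsLocalRing.maximalIdeal R, ∃ m' ∈ IsLocalRing.maximalIdeal R,
      algebraMap R K m * g = algebraMap R K m'
  · exfalso
    have := isIntegral_of_smul_mem_submodule
      (Submodule.map (Algebra.linearMap R K) (IsLocalRing.maximalIdeal R)) ?_ ?_ g ?_
    · obtain ⟨y, e⟩ := IsIntegrallyClosed.algebraMap_eq_of_integral this
      exact hg ⟨y, e⟩
    · obtain ⟨a, ha, ha'⟩ := Submodule.exists_mem_ne_zero_of_ne_bot hne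
      rw [Submodule.ne_bot_iff]
      exact ⟨_, ⟨a, ha, rfl⟩, by simpa using ha'⟩
    · exact Submodule.FG.map _ (IsNoetherian.noetherian _)
    · rintro _ ⟨m, hm, rfl⟩
      obtain ⟨m', hm', e⟩ := hx m hm
      exact ⟨m', hm', by rw [smul_eq_mul, mul_comm]; exact e.symm⟩
  · push Not at hx
    obtain ⟨y, hy, hy'⟩ := hx
    obtain ⟨z, hz⟩ := h y hy
    have hzu : IsUnit z := by
      by_contra hc
      exact hy' z hc hz.symm
    have hg0 : g ≠ 0 := fun h0 => hg (h0 ▸ zero_mem _)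
    refine ⟨⟨y, le_antisymm ?_ ?_⟩⟩
    · intro m hm
      obtain ⟨r, hr⟩ := h m hm
      rw [Ideal.submodule_span_eq, Ideal.mem_span_singleton']
      obtain ⟨u, rfl⟩ := hzu
      refine ⟨r * ↑u⁻¹, ?_⟩
      suffices h : r * y = m * u by
        rw [mul_right_comm, h, mul_assoc, Units.mul_inv, mul_one]
      apply IsFractionRing.injective R K
      simp only [map_mul]
      rw [hr, hz]; ring
    · rw [Ideal.submodule_span_eq, Ideal.span_singleton_le_iff_mem]; exact hy

theorem hartogs (B K : Type) [CommRing B] [IsDomain B] [IsNoetherianRing B] [IsIntegrallyClosed B]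
    [Field K] [Algebra B K] [IsFractionRing B K] (f : K) (hf : f ∉ (algebraMap B K).range) :
    ∃ (P : Ideal B) (_ : P.IsPrime), (∀ s ∉ P, algebraMap B K s * f ∉ (algebraMap B K).range) ∧
      ∀ (R : Type) [CommRing R] [Algebra B R] [Algebra R K] [IsScalarTower B R K]
        [IsLocalization.AtPrime R P] [IsDomain R], IsDiscreteValuationRing R := by
  let N : Submodule B K := LinearMap.range (Algebra.linearMap B K)
  have hN : ∀ x : K, x ∈ N ↔ x ∈ (algebraMap B K).range := fun x => Iff.rfl
  have hx : (N.mkQ f) ≠ 0 := by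
    simpa [hN] using hf
  obtain ⟨P, hP, hle⟩ := exists_le_isAssociatedPrime_of_isNoetherianRing B (N.mkQ f) hx
  have hP2 := hP
  rw [isAssociatedPrime_iff] at hP2
  obtain ⟨hPp, q, hq⟩ := hP2
  obtain ⟨g, rfl⟩ := N.mkQ_surjective q
  have key : ∀ (g : K) (s : B), s ∈ (⊥ : Submodule B (K ⧸ N)).colon {N.mkQ g} ↔
      algebraMap B K s * g ∈ (algebraMap B K).range := by
    intro g s
    rw [Submodule.mem_colon_singleton, Submodule.mem_bot, ← map_smul, Submodule.mkQ_apply,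
      Submodule.Quotient.mk_eq_zero, hN, Algebra.smul_def]
  refine ⟨P, hPp, fun s hs h => hs (hle ((key f s).2 h)), ?_⟩
  intro R _ _ _ _ _ _
  have : IsLocalRing R := IsLocalization.AtPrime.isLocalRing R P
  have : IsNoetherianRing R := IsLocalization.isNoetherianRing P.primeCompl R inferInstance
  have : IsIntegrallyClosed R := isIntegrallyClosed_of_isLocalization _ _ P.primeCompl_le_nonZeroDivisors
  have : IsFractionRing R K := IsFractionRing.isFractionRing_of_isDomain_of_isLocalization P.primeCompl R K
  have key' : ∀ s, s ∈ P ↔ algebraMap B K s * g ∈ (algebraMap B K).range := fun s => by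
    rw [← key g s, ← hq]
  apply dvr_of_mul R K g
  · rintro ⟨r, hr⟩
    obtain ⟨b, s, rfl⟩ := IsLocalization.exists_mk'_eq P.primeCompl r
    apply s.2
    show (s : B) ∈ P
    rw [key', ← hr]
    refine ⟨b, ?_⟩
    rw [IsScalarTower.algebraMap_apply B R K, IsScalarTower.algebraMap_apply B R K, ← map_mul,
      IsLocalization.mk'_spec']
  · intro m hm
    obtain ⟨b, s, rfl⟩ := IsLocalization.exists_mk'_eq P.primeCompl m
    rw [IsLocalization.AtPrime.mk'_mem_maximal_iff R P] at hm
    obtain ⟨c, hc⟩ := (key' b).1 hm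
    refine ⟨IsLocalization.mk' R c s, ?_⟩
    have hs : algebraMap B K s ≠ 0 := by
      have : (s : B) ≠ 0 := fun h => s.2 (h ▸ P.zero_mem)
      simpa using this
    apply mul_left_cancel₀ hs
    rw [← mul_assoc]
    simp only [IsScalarTower.algebraMap_apply B R K]
    rw [← map_mul, ← map_mul, IsLocalization.mk'_spec', IsLocalization.mk'_spec',
       ← IsScalarTower.algebraMap_apply B R K, ← IsScalarTower.algebraMap_apply B R K, hc]
  · obtain ⟨a, b, hb, rfl⟩ := IsFractionRing.div_surjective (A := B) g
    have hb0 : b ≠ 0 := nonZeroDivisors.ne_zero hb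
    have hbP : b ∈ P := by
      rw [key']
      refine ⟨a, ?_⟩
      rw [mul_div_cancel₀]
      simpa using hb0
    intro hbot
    have := (IsLocalization.AtPrime.to_map_mem_maximal_iff R P b).2 hbP
    rw [hbot, Submodule.mem_bot] at this
    apply hb0
    apply IsFractionRing.injective B K
    rw [IsScalarTower.algebraMap_apply B R K, this, map_zero, map_zero]
end BG

namespace BG
section ext
variable {R M : Type} [CommRing R] [AddCommGroup M] [Module R M] {n : ℕ}

theorem iMulti_eq_det (b : Module.Basis (Fin n) R M) (v : Fin n → M) :
    ExteriorAlgebra.ιMulti R n v = b.det v • ExteriorAlgebra.ιMulti R n b := by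
  have : ExteriorAlgebra.ιMulti R n (M := M) =
      (LinearMap.toSpanSingleton R _ (ExteriorAlgebra.ιMulti R n b)).compAlternatingMap b.det := by
    refine Module.Basis.ext_alternating b fun i h => ?_
    let σ : Equiv.Perm (Fin n) := Equiv.ofBijective i (Finite.injective_iff_bijective.1 h)
    change (ExteriorAlgebra.ιMulti R n) (b ∘ σ) = (b.det (b ∘ σ)) • ExteriorAlgebra.ιMulti R n b
    rw [AlternatingMap.map_perm, AlternatingMap.map_perm, Module.Basis.det_self, smul_assoc, one_smul]
  exact congrArg (fun g => g v) this

theorem smul_iMulti_eq_zero (b : Module.Basis (Fin n) R M) (c : R)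
    (h : c • ExteriorAlgebra.ιMulti R n b = 0) : c = 0 := by
  classical
  let F : (i : ℕ) → M [⋀^Fin i]→ₗ[R] R := fun i => if h : i = n then h ▸ b.det else 0
  have h2 := congrArg (ExteriorAlgebra.liftAlternating F) h
  rw [map_smul, ExteriorAlgebra.liftAlternating_apply_ιMulti] at h2
  simpa [F, Module.Basis.det_self] using h2

theorem exists_coeff (b : Module.Basis (Fin n) R M) (w : ExteriorAlgebra R M) (hw : w ∈ ⋀[R]^n M) :
    ∃ c : R, w = c • ExteriorAlgebra.ιMulti R n b := by
  rw [← ExteriorAlgebra.ιMulti_span_fixedDegree] at hw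
  induction hw using Submodule.span_induction with
  | mem x h => obtain ⟨v, rfl⟩ := h; exact ⟨_, iMulti_eq_det b v⟩
  | zero => exact ⟨0, by simp⟩
  | add x y _ _ hx hy =>
    obtain ⟨c, rfl⟩ := hx; obtain ⟨d, rfl⟩ := hy; exact ⟨c + d, by rw [add_smul]⟩
  | smul r x _ hx => obtain ⟨c, rfl⟩ := hx; exact ⟨r * c, by rw [mul_smul]⟩

theorem exists_unit_coeff (b : Module.Basis (Fin n) R M) (w : ExteriorAlgebra R M) (hw : w ∈ ⋀[R]^n M)
    (hg : ⋀[R]^n M ≤ Submodule.span R {w}) :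
    ∃ c : Rˣ, w = (c : R) • ExteriorAlgebra.ιMulti R n b := by
  obtain ⟨c, rfl⟩ := exists_coeff b w hw
  have : ExteriorAlgebra.ιMulti R n b ∈ ⋀[R]^n M := by
    rw [← ExteriorAlgebra.ιMulti_span_fixedDegree]; exact Submodule.subset_span ⟨_, rfl⟩
  obtain ⟨d, hd⟩ := Submodule.mem_span_singleton.1 (hg this)
  have h0 : (d * c - 1) • ExteriorAlgebra.ιMulti R n b = 0 := by
    rw [sub_smul, mul_smul, hd, one_smul, sub_self]
  have := smul_iMulti_eq_zero b _ h0
  exact ⟨⟨c, d, by linear_combination this, by linear_combination this⟩, rfl⟩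
end ext

section T
variable (R A B C : Type) [CommRing R] [CommRing A] [CommRing B] [CommRing C]
    [Algebra R A] [Algebra R B] [Algebra R C] [Algebra A B] [Algebra A C] [Algebra B C]
    [IsScalarTower R A B] [IsScalarTower R A C] [IsScalarTower R B C] [IsScalarTower A B C]

theorem T_add (v w : ExteriorAlgebra A (Ω[A⁄R])) :
   formTransfer R A B (v + w) = formTransfer R A B v + formTransfer R A B w := by
  unfold formTransfer
  exact map_add _ _ _
theorem T_mul (v w : ExteriorAlgebra A (Ω[A⁄R])) :
   formTransfer R A B (v * w) = formTransfer R A B v * formTransfer R A B w := by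
  unfold formTransfer
  exact map_mul _ _ _
theorem T_algebraMap (a : A) :
   formTransfer R A B (algebraMap A _ a) = algebraMap B _ (algebraMap A B a) := by
  unfold formTransfer
  exact AlgHom.commutes _ _
theorem T_one : formTransfer R A B 1 = 1 := by
  unfold formTransfer
  exact map_one _
theorem T_ι (x : Ω[A⁄R]) :
   formTransfer R A B (ExteriorAlgebra.ι A x) = ExteriorAlgebra.ι B (KaehlerDifferential.map R R A B x) := by
  unfold formTransfer
  exact ExteriorAlgebra.lift_ι_apply _ _ _ _
theorem T_smul (a : A) (w : ExteriorAlgebra A (Ω[A⁄R])) :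
   formTransfer R A B (a • w) = algebraMap A B a • formTransfer R A B w := by
  rw [Algebra.smul_def, T_mul, T_algebraMap, ← Algebra.smul_def]
theorem T_iMulti {n : ℕ} (v : Fin n → Ω[A⁄R]) :
   formTransfer R A B (ExteriorAlgebra.ιMulti A n v) =
    ExteriorAlgebra.ιMulti B n (fun i => KaehlerDifferential.map R R A B (v i)) := by
  induction n with
  | zero => simp [ExteriorAlgebra.ιMulti_apply, T_one]
  | succ n ih =>
    rw [ExteriorAlgebra.ιMulti_succ_apply, T_mul, T_ι, ih, ExteriorAlgebra.ιMulti_succ_apply]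
    rfl
theorem T_comp (w : ExteriorAlgebra A (Ω[A⁄R])) :
    formTransfer R B C (formTransfer R A B w) = formTransfer R A C w := by
  induction w using ExteriorAlgebra.induction with
  | algebraMap r => rw [T_algebraMap, T_algebraMap, T_algebraMap, ← IsScalarTower.algebraMap_apply A B C]
  | ι x =>
    rw [T_ι, T_ι, T_ι]
    congr 1
    have h : x ∈ Submodule.span A (Set.range (KaehlerDifferential.D R A)) := by
      rw [KaehlerDifferential.span_range_derivation]; trivial
    induction h using Submodule.span_induction with
    | mem x h => obtain ⟨x, rfl⟩ := h; simp [← IsScalarTower.algebraMap_apply A B C]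
    | zero => simp
    | add x y _ _ hx hy => rw [map_add, map_add, map_add, hx, hy]
    | smul r x _ hx =>
      rw [(KaehlerDifferential.map R R A B).map_smul, (KaehlerDifferential.map R R A C).map_smul, ← hx,
        ← algebraMap_smul B r (KaehlerDifferential.map R R A B x),
        (KaehlerDifferential.map R R B C).map_smul, algebraMap_smul]
  | mul a b ha hb => rw [T_mul, T_mul, T_mul, ha, hb]
  | add a b ha hb => rw [T_add, T_add, T_add, ha, hb]

theorem formallyEtale_of_det {n : ℕ} [Algebra.FormallySmooth R B]
    (a : Module.Basis (Fin n) A (Ω[A⁄R])) (b : Module.Basis (Fin n) B (Ω[B⁄R]))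
    (h : IsUnit (b.det (fun i => KaehlerDifferential.map R R A B (a i)))) :
    Algebra.FormallyEtale A B := by
  have hbij : Function.Bijective (KaehlerDifferential.mapBaseChange R A B) := by
    rw [← Module.Basis.is_basis_iff_det] at h
    let c := Module.Basis.mk h.1 h.2.ge
    let e := (a.baseChange B).equiv c (Equiv.refl _)
    have : KaehlerDifferential.mapBaseChange R A B = e.toLinearMap := by
      refine (a.baseChange B).ext fun i => ?_
      have h5 : e (a.baseChange B i) = c i := (a.baseChange B).equiv_apply i c (Equiv.refl _)
      rw [LinearEquiv.coe_coe, h5]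
      simp [c]
    rw [this]
    exact e.bijective
  have h1 : Subsingleton (Ω[B⁄A]) := by
    refine subsingleton_of_forall_eq 0 fun x => ?_
    obtain ⟨y, rfl⟩ := KaehlerDifferential.map_surjective R A B x
    obtain ⟨z, rfl⟩ := hbij.2 y
    exact (KaehlerDifferential.exact_mapBaseChange_map R A B _).2 ⟨z, rfl⟩
  have h2 : Subsingleton (Algebra.H1Cotangent A B) := by
    refine subsingleton_of_forall_eq 0 fun x => ?_
    have h3 : Algebra.H1Cotangent.δ R A B x = 0 := by
      apply hbij.1
      rw [map_zero]
      exact (Algebra.H1Cotangent.exact_δ_mapBaseChange R A B _).2 ⟨x, rfl⟩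
    obtain ⟨y, rfl⟩ := (Algebra.H1Cotangent.exact_map_δ R A B _).1 h3
    rw [Subsingleton.elim y 0, map_zero]
  exact Algebra.FormallyEtale.mk h1 h2

/-- The basic comparison of forms in a chart. -/
theorem chart_forms {n : ℕ} (R A B K : Type) [Field R] [CommRing A] [CommRing B] [Field K]
    [Algebra R A] [Algebra R B] [Algebra R K] [Algebra A B] [Algebra A K] [Algebra B K]
    [IsScalarTower R A B] [IsScalarTower R A K] [IsScalarTower R B K] [IsScalarTower A B K]
    [IsDomain B] [IsFractionRing B K] [Nontrivial A]
    [Algebra.IsStandardSmoothOfRelativeDimension n R A]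
    [Algebra.IsStandardSmoothOfRelativeDimension n R B]
    (wA : ExteriorAlgebra A (Ω[A⁄R])) (wB : ExteriorAlgebra B (Ω[B⁄R]))
    (hA : wA ∈ ⋀[A]^n (Ω[A⁄R])) (hA' : ⋀[A]^n (Ω[A⁄R]) ≤ Submodule.span A {wA})
    (hB : wB ∈ ⋀[B]^n (Ω[B⁄R])) (hB' : ⋀[B]^n (Ω[B⁄R]) ≤ Submodule.span B {wB}) :
    formTransfer R B K wB ≠ 0 ∧ (∃ β : B, formTransfer R A K wA = algebraMap B K β • formTransfer R B K wB ∧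
      (IsUnit β → Algebra.FormallyEtale A B)) ∧
      ((∀ x : K, ∃ a s : A, algebraMap A K s ≠ 0 ∧ x * algebraMap A K s = algebraMap A K a) →
        formTransfer R A K wA ≠ 0) := by
  have : Nontrivial B := inferInstance
  have sA : Algebra.IsStandardSmooth R A := Algebra.IsStandardSmoothOfRelativeDimension.isStandardSmooth n
  have sB : Algebra.IsStandardSmooth R B := Algebra.IsStandardSmoothOfRelativeDimension.isStandardSmooth n
  have hrA := Algebra.IsStandardSmoothOfRelativeDimension.rank_kaehlerDifferential (R := R) (S := A) n
  have hrB := Algebra.IsStandardSmoothOfRelativeDimension.rank_kaehlerDifferential (R := R) (S := B) n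
  let a : Module.Basis (Fin n) A (Ω[A⁄R]) :=
    Module.finBasisOfFinrankEq _ _ (Module.finrank_eq_of_rank_eq hrA)
  let b : Module.Basis (Fin n) B (Ω[B⁄R]) :=
    Module.finBasisOfFinrankEq _ _ (Module.finrank_eq_of_rank_eq hrB)
  have hloc : IsLocalizedModule (nonZeroDivisors B) (KaehlerDifferential.map R R B K) :=
    KaehlerDifferential.isLocalizedModule_map R B K (nonZeroDivisors B)
  let κ : Module.Basis (Fin n) K (Ω[K⁄R]) := b.ofIsLocalizedModule K (nonZeroDivisors B) (KaehlerDifferential.map R R B K)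
  have hκ : (fun i => KaehlerDifferential.map R R B K (b i)) = κ := by
    funext i
    simp [κ]
  obtain ⟨uA, rfl⟩ := exists_unit_coeff a wA hA hA'
  obtain ⟨uB, rfl⟩ := exists_unit_coeff b wB hB hB'
  have hne : ∀ κ : Module.Basis (Fin n) K (Ω[K⁄R]), ExteriorAlgebra.ιMulti K n κ ≠ 0 :=
    fun κ h => one_ne_zero (smul_iMulti_eq_zero κ (1 : K) (by rw [h, smul_zero]))
  refine ⟨?_, ⟨algebraMap A B uA * b.det (fun i => KaehlerDifferential.map R R A B (a i)) * ↑uB⁻¹, ?_, ?_⟩, ?_⟩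
  · rw [T_smul, T_iMulti, hκ]
    refine smul_ne_zero ?_ (hne κ)
    exact (uB.isUnit.map (algebraMap B K)).ne_zero
  · rw [← T_comp R A B K, T_smul R A B, T_iMulti, T_smul R B K, iMulti_eq_det b, T_smul R B K, T_smul R B K,
      smul_smul, smul_smul, ← map_mul, ← map_mul, mul_assoc _ _ (uB : B), Units.inv_mul, mul_one]
  · intro h
    apply formallyEtale_of_det R A B a b
    exact isUnit_of_mul_isUnit_right (isUnit_of_mul_isUnit_left h)
  · intro hs
    rw [T_smul, T_iMulti]
    refine smul_ne_zero (uA.isUnit.map (algebraMap A K)).ne_zero ?_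
    have hspan : ⊤ ≤ Submodule.span K (Set.range (fun i => KaehlerDifferential.map R R A K (a i))) := by
      have h1 : ∀ y : Ω[A⁄R], KaehlerDifferential.map R R A K y ∈
          Submodule.span K (Set.range (fun i => KaehlerDifferential.map R R A K (a i))) := by
        intro y
        rw [← a.sum_repr y, map_sum]
        refine Submodule.sum_mem _ fun i _ => ?_
        rw [(KaehlerDifferential.map R R A K).map_smul, ← algebraMap_smul K]
        exact Submodule.smul_mem _ _ (Submodule.subset_span ⟨i, rfl⟩)
      rw [← KaehlerDifferential.span_range_derivation, Submodule.span_le]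
      rintro _ ⟨x, rfl⟩
      obtain ⟨p, s, hs, e⟩ := hs x
      have e2 := congrArg (KaehlerDifferential.D R K) e
      rw [Derivation.leibniz, ← KaehlerDifferential.map_D R R A K, ← KaehlerDifferential.map_D R R A K] at e2
      have e3 : algebraMap A K s • KaehlerDifferential.D R K x ∈
          Submodule.span K (Set.range (fun i => KaehlerDifferential.map R R A K (a i))) := by
        rw [← eq_sub_iff_add_eq'] at e2
        rw [e2]
        exact Submodule.sub_mem _ (h1 _) (Submodule.smul_mem _ _ (h1 _))
      exact (Submodule.smul_mem_iff _ hs).1 e3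
    let κ' := basisOfTopLeSpanOfCardEqFinrank _ hspan (by
      rw [Module.finrank_eq_card_basis κ])
    have := hne κ'
    rwa [coe_basisOfTopLeSpanOfCardEqFinrank] at this
end T
end BG

namespace BG

theorem surj_of_flat (A B K : Type) [CommRing A] [CommRing B] [Field K] [IsLocalRing A] [IsLocalRing B]
    [IsDomain B]
    (θ : A →+* B) (κ : B →+* K) [IsLocalHom θ] (hκ : Function.Injective κ) (hflat : θ.Flat)
    (h : ∀ x : K, ∃ a s : A, κ (θ s) ≠ 0 ∧ x * κ (θ s) = κ (θ a)) : Function.Surjective θ := by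
  algebraize [θ]
  have : Module.FaithfullyFlat A B := Module.FaithfullyFlat.of_flat_of_isLocalHom
  intro b
  obtain ⟨a, s, hs, e⟩ := h (κ b)
  have hs0 : θ s ≠ 0 := fun h => hs (by rw [h, map_zero])
  have e1 : b * θ s = θ a := hκ (by rw [map_mul, e])
  have h1 : a ∈ ((Ideal.span {s}).map (algebraMap A B)).comap (algebraMap A B) := by
    rw [Ideal.mem_comap, Ideal.map_span, Set.image_singleton, Ideal.mem_span_singleton']
    exact ⟨b, e1⟩
  rw [Ideal.comap_map_eq_self_of_faithfullyFlat, Ideal.mem_span_singleton'] at h1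
  obtain ⟨c, rfl⟩ := h1
  rw [map_mul] at e1
  exact ⟨c, (mul_right_cancel₀ hs0 e1).symm⟩

theorem divisible_dvr (O K : Type) [CommRing O] [IsDomain O] [IsDiscreteValuationRing O] [Field K] [Algebra O K]
    [IsFractionRing O K] (σ : ℂ →+* K) (c : ℂ) : σ c ∈ (algebraMap O K).range := by
  by_contra hc
  have hval := ValuationRing.isInteger_or_isInteger O (σ c)
  rcases hval with h | ⟨u, hu⟩
  · exact hc h
  have hc0 : c ≠ 0 := by rintro rfl; exact hc (by rw [map_zero]; exact zero_mem _)
  have hσ : σ c ≠ 0 := by simpa using hc0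
  have hu0 : u ≠ 0 := by rintro rfl; rw [map_zero] at hu; exact inv_ne_zero hσ hu.symm
  have huu : ¬ IsUnit u := by
    rintro ⟨v, rfl⟩
    apply hc
    refine ⟨↑v⁻¹, ?_⟩
    have : algebraMap O K (v : O) * algebraMap O K (↑v⁻¹ : O) = 1 := by rw [← map_mul, Units.mul_inv, map_one]
    rw [hu] at this
    field_simp at this
    rw [this]
  have key : ∀ m : ℕ, u ∈ IsLocalRing.maximalIdeal O ^ m := by
    intro m
    rcases Nat.eq_zero_or_pos m with rfl | hm
    · simp
    obtain ⟨d, hd⟩ := IsAlgClosed.exists_pow_nat_eq c⁻¹ hm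
    have ht : IsIntegral O (σ d) := by
      refine IsIntegral.of_pow hm ?_
      rw [← map_pow, hd, map_inv₀, ← hu]
      exact isIntegral_algebraMap
    obtain ⟨t, ht⟩ := IsIntegrallyClosed.algebraMap_eq_of_integral ht
    have e : t ^ m = u := by
      apply IsFractionRing.injective O K
      rw [map_pow, ht, ← map_pow, hd, map_inv₀, hu]
    rw [← e]
    apply Ideal.pow_mem_pow
    intro htu
    exact huu (e ▸ htu.pow m)
  have := Ideal.iInf_pow_eq_bot_of_isLocalRing (IsLocalRing.maximalIdeal O) (Ideal.IsPrime.ne_top inferInstance)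
  apply hu0
  rw [← Ideal.mem_bot, ← this]
  exact (Submodule.mem_iInf _).2 key

section hom
variable {R A B C : Type} [CommRing R] [CommRing A] [CommRing B] [CommRing C]

/-- Forms attached to a ring homomorphism. -/
abbrev Ext (j : R →+* A) : Type := letI := j.toAlgebra; ExteriorAlgebra A (Ω[A⁄R])

def Ext.Good {j : R →+* A} (n : ℕ) (w : Ext j) : Prop :=
  letI := j.toAlgebra
  let w' : ExteriorAlgebra A (Ω[A⁄R]) := w
  w' ∈ ⋀[A]^n (Ω[A⁄R]) ∧ (⋀[A]^n (Ω[A⁄R]) ≤ Submodule.span A {w'})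

/-- Transfer of forms. -/
noncomputable def TT {j : R →+* A} {i : R →+* B} (θ : A →+* B) (h : θ.comp j = i) : Ext j → Ext i :=
  letI := j.toAlgebra
  letI := i.toAlgebra
  letI := θ.toAlgebra
  letI : IsScalarTower R A B := IsScalarTower.of_algebraMap_eq' h.symm
  formTransfer R A B

theorem TT_comp {j : R →+* A} {i : R →+* B} {l : R →+* C} (θ : A →+* B) (h : θ.comp j = i)
    (κ : B →+* C) (h' : κ.comp i = l) (σ : A →+* C) (h'' : κ.comp θ = σ) (w : Ext j) :
    TT κ h' (TT θ h w) = TT (i := l) σ (by rw [← h'', ← h', ← h, RingHom.comp_assoc]) w := by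
  subst h h' h''
  let := j.toAlgebra
  let := θ.toAlgebra
  let := (θ.comp j).toAlgebra
  let := κ.toAlgebra
  let := (κ.comp θ).toAlgebra
  let := (κ.comp (θ.comp j)).toAlgebra
  let : IsScalarTower R A B := IsScalarTower.of_algebraMap_eq' rfl
  let : IsScalarTower R A C := IsScalarTower.of_algebraMap_eq' rfl
  let : IsScalarTower R B C := IsScalarTower.of_algebraMap_eq' rfl
  let : IsScalarTower A B C := IsScalarTower.of_algebraMap_eq' rfl
  exact T_comp R A B C w

theorem chart_forms' {n : ℕ} {R A B K : Type} [Field R] [CommRing A] [CommRing B] [Field K]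
    [IsDomain B] [Nontrivial A] {j : R →+* A} {i : R →+* B} {l : R →+* K} (θ : A →+* B) (h : θ.comp j = i)
    (κ : B →+* K) (h' : κ.comp i = l) (σ : A →+* K) (h'' : κ.comp θ = σ)
    (hK : letI := κ.toAlgebra; IsFractionRing B K)
    (hj : j.IsStandardSmoothOfRelativeDimension n) (hi : i.IsStandardSmoothOfRelativeDimension n)
    (wA : Ext j) (wB : Ext i) (hA : wA.Good n) (hB : wB.Good n) :
    TT κ h' wB ≠ 0 ∧ (∃ β : B, TT (i := l) σ (by rw [← h'', ← h', ← h, RingHom.comp_assoc]) wA =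
        κ β • TT κ h' wB ∧ (IsUnit β → θ.FormallyEtale)) ∧
      ((∀ x : K, ∃ a s : A, σ s ≠ 0 ∧ x * σ s = σ a) →
        TT (i := l) σ (by rw [← h'', ← h', ← h, RingHom.comp_assoc]) wA ≠ 0) := by
  subst h h' h''
  let := j.toAlgebra
  let := θ.toAlgebra
  let := (θ.comp j).toAlgebra
  let := κ.toAlgebra
  let := (κ.comp θ).toAlgebra
  let := (κ.comp (θ.comp j)).toAlgebra
  let : IsScalarTower R A B := IsScalarTower.of_algebraMap_eq' rfl
  let : IsScalarTower R A K := IsScalarTower.of_algebraMap_eq' rfl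
  let : IsScalarTower R B K := IsScalarTower.of_algebraMap_eq' rfl
  let : IsScalarTower A B K := IsScalarTower.of_algebraMap_eq' rfl
  have : IsFractionRing B K := hK
  have : Algebra.IsStandardSmoothOfRelativeDimension n R A := hj
  have : Algebra.IsStandardSmoothOfRelativeDimension n R B := hi
  exact chart_forms (n := n) R A B K wA wB hA.1 hA.2 hB.1 hB.2
end hom

end BG

namespace BG

theorem opens_specC (W : (Spec ℂRing).Opens) (h : (W : Set (Spec ℂRing)).Nonempty) : W = ⊤ := by
  have : Subsingleton (Spec ℂRing) := inferInstanceAs (Subsingleton (PrimeSpectrum ℂ))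
  obtain ⟨x, hx⟩ := h
  ext y
  simpa [Subsingleton.elim y x] using hx

/-- Structure map to sections. -/
noncomputable def sH (X : Scheme.{0}) [X.Over (Spec ℂRing)] (W : X.Opens) : ℂ →+* Γ(X, W) := secHom ℂRing X W

theorem sH_eq (X : Scheme.{0}) [X.Over (Spec ℂRing)] (W : X.Opens) : sH X W =
    ((Scheme.ΓSpecIso ℂRing).inv ≫ (X ↘ Spec ℂRing).appLE ⊤ W (fun _ _ => trivial)).hom := rfl

theorem sH_res (X : Scheme.{0}) [X.Over (Spec ℂRing)] (W W' : X.Opens) (h : W' ≤ W) :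
    (X.presheaf.map (homOfLE h).op).hom.comp (sH X W) = sH X W' := by
  rw [sH_eq, sH_eq, ← Scheme.Hom.appLE_map (X ↘ Spec ℂRing) (U := ⊤) (V := W) (fun _ _ => trivial) (homOfLE h).op]
  rfl

theorem exists_std (n : ℕ) (X : Scheme.{0}) [X.Over (Spec ℂRing)]
    [SmoothOfRelativeDimension n (X ↘ Spec ℂRing)] (x : X) (O : X.Opens) (hx : x ∈ O) :
    ∃ W : X.Opens, IsAffineOpen W ∧ x ∈ W ∧ W ≤ O ∧
      (sH X W).IsStandardSmoothOfRelativeDimension n := by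
  obtain ⟨S, hS, V, hV, hxV, e, H⟩ :=
    SmoothOfRelativeDimension.exists_isStandardSmoothOfRelativeDimension (n := n) (f := X ↘ Spec ℂRing) x
  obtain rfl := opens_specC S ⟨_, e hxV⟩
  obtain ⟨f, hf, hxf⟩ := hV.exists_basicOpen_le ⟨x, hx⟩ hxV
  refine ⟨X.basicOpen f, hV.basicOpen f, hxf, hf, ?_⟩
  have h1 : (sH X V).IsStandardSmoothOfRelativeDimension n := by
    rw [sH_eq, CommRingCat.hom_comp]
    refine (RingHom.isStandardSmoothOfRelativeDimension_respectsIso (n := n)).2 (R := ℂ) (S := Γ(Spec ℂRing, ⊤)) (T := Γ(X, V)) _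
      ((Scheme.ΓSpecIso ℂRing).symm.commRingCatIsoToRingEquiv) H
  rw [← sH_res X V _ (X.basicOpen_le f)]
  have := hV.isLocalization_basicOpen f
  exact (RingHom.isStandardSmoothOfRelativeDimension_stableUnderCompositionWithLocalizationAway n).right
      _ f _ h1

/-- The components of a gauge form. -/
def gform {n : ℕ} {X : Scheme.{0}} [X.Over (Spec ℂRing)] (G : GaugeForm ℂRing X n) (W : X.Opens)
    (hW : IsAffineOpen W) : Ext (sH X W) := G.form W hW

theorem form_good {n : ℕ} {X : Scheme.{0}} [X.Over (Spec ℂRing)] (G : GaugeForm ℂRing X n) (W : X.Opens)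
    (hW : IsAffineOpen W) : (gform G W hW).Good n :=
  ⟨G.isDegree W hW, G.generates W hW⟩

theorem TT_congr {R A B : Type} [CommRing R] [CommRing A] [CommRing B] {j : R →+* A} {i : R →+* B}
    (θ θ' : A →+* B) (h : θ.comp j = i) (h' : θ'.comp j = i) (w : Ext j) (e : θ = θ') :
    TT θ h w = TT θ' h' w := by subst e; rfl

theorem form_res {n : ℕ} {X : Scheme.{0}} [X.Over (Spec ℂRing)] (G : GaugeForm ℂRing X n) (W W' : X.Opens)
    (hW : IsAffineOpen W) (hW' : IsAffineOpen W') (h : W' ≤ W) :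
    TT (X.presheaf.map (homOfLE h).op).hom (sH_res X W W' h) (gform G W hW) = gform G W' hW' := by
  have h2 : (X.presheaf.map (homOfLE h).op).hom = ((𝟙 X : X ⟶ X).appLE W W' (by simpa using h)).hom := by
    rw [Scheme.Hom.appLE, Scheme.Hom.id_app]
    erw [Category.id_comp]
    rfl
  rw [TT_congr _ _ _ (h2 ▸ sH_res X W W' h) _ h2]
  exact G.compat W W' hW hW' h

/-- All transfers of a gauge form to `L` through a fixed stalk agree. -/
theorem form_indep {n : ℕ} {X : Scheme.{0}} [X.Over (Spec ℂRing)] (G : GaugeForm ℂRing X n) (W W' : X.Opens)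
    (hW : IsAffineOpen W) (hW' : IsAffineOpen W') (x : X) (hx : x ∈ W) (hx' : x ∈ W') {L : Type} [CommRing L]
    (κ : X.presheaf.stalk x →+* L) (l : ℂ →+* L)
    (e : (κ.comp (X.presheaf.germ W x hx).hom).comp (sH X W) = l)
    (e' : (κ.comp (X.presheaf.germ W' x hx').hom).comp (sH X W') = l) :
    TT (j := sH X W) (κ.comp (X.presheaf.germ W x hx).hom) e (gform G W hW) =
    TT (j := sH X W') (κ.comp (X.presheaf.germ W' x hx').hom) e' (gform G W' hW') := by
  obtain ⟨_, ⟨W₀, hW₀, rfl⟩, hx₀, hle⟩ :=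
    X.isBasis_affineOpens.exists_subset_of_mem_open (a := x) (u := (W ⊓ W' : X.Opens)) ⟨hx, hx'⟩ (W ⊓ W').2
  have key : ∀ (W : X.Opens) (hW : IsAffineOpen W) (hx : x ∈ W) (h : W₀ ≤ W)
    (e : (κ.comp (X.presheaf.germ W x hx).hom).comp (sH X W) = l)
    (e' : (κ.comp (X.presheaf.germ W₀ x hx₀).hom).comp (sH X W₀) = l),
    TT (j := sH X W) (κ.comp (X.presheaf.germ W x hx).hom) e (gform G W hW) =
    TT (j := sH X W₀) (κ.comp (X.presheaf.germ W₀ x hx₀).hom) e' (gform G W₀ hW₀) := by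
    intro W hW hx h e e'
    rw [← form_res G W W₀ hW hW₀ h]
    symm
    apply TT_comp
    rw [RingHom.comp_assoc, ← CommRingCat.hom_comp, TopCat.Presheaf.germ_res]
  have e0 : (κ.comp (X.presheaf.germ W₀ x hx₀).hom).comp (sH X W₀) = l := by
    rw [← sH_res X W W₀ (hle.trans inf_le_left), ← e, RingHom.comp_assoc, RingHom.comp_assoc, ← RingHom.comp_assoc (sH X W),
      ← CommRingCat.hom_comp, TopCat.Presheaf.germ_res]
  rw [key W hW hx (hle.trans inf_le_left) e e0, key W' hW' hx' (hle.trans inf_le_right) e' e0]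

end BG

namespace BG

theorem gen_mem (X : Scheme.{0}) [IsIntegral X] {W : X.Opens} {x : X} (hx : x ∈ W) : genericPoint X ∈ W :=
  ((genericPoint_spec X).mem_open_set_iff W.isOpen).mpr ⟨x, trivial, hx⟩

theorem frac_stalk (Y : Scheme.{0}) (V : Y.Opens) (hV : IsAffineOpen V) (y : Y) (hy : y ∈ V)
    (t : Y.presheaf.stalk y) : ∃ a s : Γ(Y, V), IsUnit (Y.presheaf.germ V y hy s) ∧
      t * Y.presheaf.germ V y hy s = Y.presheaf.germ V y hy a := by
  letI : Algebra Γ(Y, V) (Y.presheaf.stalk y) := (Y.presheaf.germ V y hy).hom.toAlgebra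
  have : IsLocalization.AtPrime (Y.presheaf.stalk y) (hV.primeIdealOf ⟨y, hy⟩).asIdeal :=
    hV.isLocalization_stalk ⟨y, hy⟩
  obtain ⟨⟨a, s⟩, h⟩ := IsLocalization.surj (hV.primeIdealOf ⟨y, hy⟩).asIdeal.primeCompl t
  exact ⟨a, s, IsLocalization.map_units (Y.presheaf.stalk y) s, h⟩

theorem top_le' {X Y : Scheme.{0}} (f : X ⟶ Y) (W : X.Opens) : W ≤ f ⁻¹ᵁ ⊤ := fun _ _ => trivial

section
variable {X Y : Scheme.{0}} [IsIntegral X] {U : X.Opens} (φ₀ : U.toScheme ⟶ Y) (hη : genericPoint X ∈ U)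

/-- The generic point of an open subscheme. -/
noncomputable def etaU {X : Scheme.{0}} [IsIntegral X] {U : X.Opens} (hη : genericPoint X ∈ U) : U.toScheme :=
  ⟨genericPoint X, hη⟩

theorem etaU_ι : U.ι (etaU hη) = genericPoint X := rfl

theorem etaU_mem {W : U.toScheme.Opens} (h : etaU hη ∈ W) : genericPoint X ∈ U.ι ''ᵁ W := ⟨_, h, rfl⟩

/-- The map on stalks to the function field. -/
noncomputable def rho : Y.presheaf.stalk (φ₀ (etaU hη)) ⟶ X.functionField :=
  φ₀.stalkMap (etaU hη) ≫ (U.stalkIso (etaU hη)).hom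

theorem mem_of {X Y : Scheme.{0}} (f : X ⟶ Y) {V : Y.Opens} {W : X.Opens} (e : W ≤ f ⁻¹ᵁ V) {x : X} (hx : x ∈ W) :
    f x ∈ V := e hx

theorem appLE_germ {X Y : Scheme.{0}} (f : X ⟶ Y) (V : Y.Opens) (W : X.Opens) (e : W ≤ f ⁻¹ᵁ V) (x : X) (hx : x ∈ W) :
    f.appLE V W e ≫ X.presheaf.germ W x hx = Y.presheaf.germ V (f x) (mem_of f e hx) ≫ f.stalkMap x := by
  rw [Scheme.Hom.germ_stalkMap, Scheme.Hom.appLE, Category.assoc, TopCat.Presheaf.germ_res]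

theorem germ_rho (V : Y.Opens) (W : U.toScheme.Opens) (e : W ≤ φ₀ ⁻¹ᵁ V) (hW : etaU hη ∈ W) :
    Y.presheaf.germ V (φ₀ (etaU hη)) (mem_of φ₀ e hW) ≫ rho φ₀ hη =
      φ₀.appLE V W e ≫ X.presheaf.germ (U.ι ''ᵁ W) (genericPoint X) (etaU_mem hη hW) := by
  have h1 := Scheme.Opens.germ_stalkIso_hom U (etaU hη) hW
  have h2 := appLE_germ φ₀ V W e (etaU hη) hW
  refine (Category.assoc _ _ _).symm.trans ?_
  refine (congrArg (fun g => g ≫ (U.stalkIso (etaU hη)).hom) h2.symm).trans ?_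
  refine (Category.assoc _ _ _).trans ?_
  exact congrArg (fun g => φ₀.appLE V W e ≫ g) h1

theorem appLE_sH [X.Over (Spec ℂRing)] [Y.Over (Spec ℂRing)]
    (hφ₀over : φ₀ ≫ (Y ↘ Spec ℂRing) = U.ι ≫ (X ↘ Spec ℂRing))
    (V : Y.Opens) (W : U.toScheme.Opens) (e : W ≤ φ₀ ⁻¹ᵁ V) :
    (φ₀.appLE V W e).hom.comp (sH Y V) = sH X (U.ι ''ᵁ W) := by
  have h1 : (Y ↘ Spec ℂRing).appLE ⊤ V (top_le' _ _) ≫ φ₀.appLE V W e =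
     (X ↘ Spec ℂRing).appLE ⊤ (U.ι ''ᵁ W) (top_le' _ _) := by
    rw [Scheme.Hom.appLE_comp_appLE]
    have : ∀ (g : U.toScheme ⟶ Spec ℂRing) (e), g = U.ι ≫ (X ↘ Spec ℂRing) →
      g.appLE ⊤ W e = (X ↘ Spec ℂRing).appLE ⊤ (U.ι ''ᵁ W) (top_le' _ _) := by
      rintro g e rfl
      have h3 : W ≤ U.ι ⁻¹ᵁ (U.ι ''ᵁ W) := by rw [Scheme.Hom.preimage_image_eq]
      rw [← Scheme.Hom.appLE_comp_appLE U.ι (X ↘ Spec ℂRing) ⊤ (U.ι ''ᵁ W) W (top_le' _ _) h3]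
      rw [Scheme.Opens.ι_appLE]
      exact (Scheme.Hom.appLE_map _ _ _)
    exact this _ _ hφ₀over
  rw [sH_eq, sH_eq]
  exact congrArg (fun g => ((Scheme.ΓSpecIso ℂRing).inv ≫ g).hom) h1
end

/-- The structure map to the function field. -/
noncomputable def lK (X : Scheme.{0}) [X.Over (Spec ℂRing)] [IsIntegral X] : ℂ →+* X.functionField :=
  (X.presheaf.germ ⊤ (genericPoint X) trivial).hom.comp (sH X ⊤)

theorem germ_sH (X : Scheme.{0}) [X.Over (Spec ℂRing)] [IsIntegral X] (W : X.Opens) (h : genericPoint X ∈ W) :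
    (X.presheaf.germ W (genericPoint X) h).hom.comp (sH X W) = lK X := by
  rw [← sH_res X ⊤ W le_top, ← RingHom.comp_assoc, ← CommRingCat.hom_comp, TopCat.Presheaf.germ_res]
  rfl

theorem rho_sH {X Y : Scheme.{0}} [IsIntegral X] {U : X.Opens} (φ₀ : U.toScheme ⟶ Y) (hη : genericPoint X ∈ U)
    [X.Over (Spec ℂRing)] [Y.Over (Spec ℂRing)]
    (hφ₀over : φ₀ ≫ (Y ↘ Spec ℂRing) = U.ι ≫ (X ↘ Spec ℂRing))
    (V : Y.Opens) (W : U.toScheme.Opens) (e : W ≤ φ₀ ⁻¹ᵁ V) (hW : etaU hη ∈ W) :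
    ((rho φ₀ hη).hom.comp (Y.presheaf.germ V (φ₀ (etaU hη)) (mem_of φ₀ e hW)).hom).comp (sH Y V) = lK X := by
  have h := congrArg CommRingCat.Hom.hom (germ_rho φ₀ hη V W e hW)
  refine (congrArg (fun g : Γ(Y, V) →+* X.functionField => g.comp (sH Y V)) h).trans ?_
  refine Eq.trans ?_ (germ_sH X _ (etaU_mem hη hW))
  rw [← appLE_sH φ₀ hφ₀over V W e]
  rfl

theorem ext_smul_cancel {R K : Type} [CommRing R] [Field K] {l : R →+* K} (w : Ext l) (hw : w ≠ 0) (a b : K)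
    (h : a • w = b • w) : a = b := by
  let := l.toAlgebra
  exact smul_left_injective K (M := ExteriorAlgebra K (Ω[K⁄R])) hw h

theorem charts (n : ℕ) (X Y : Scheme.{0})
    [X.Over (Spec ℂRing)] [Y.Over (Spec ℂRing)]
    [IsIntegral X] [IsIntegral Y]
    [SmoothOfRelativeDimension n (X ↘ Spec ℂRing)]
    [SmoothOfRelativeDimension n (Y ↘ Spec ℂRing)]
    (GX : GaugeForm ℂRing X n) (GY : GaugeForm ℂRing Y n)
    (U : X.Opens)
    (φ₀ : U.toScheme ⟶ Y)
    (hφ₀over : φ₀ ≫ (Y ↘ Spec ℂRing) = U.ι ≫ (X ↘ Spec ℂRing)) (hη : genericPoint X ∈ U)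
    (hsurj : Function.Surjective (rho φ₀ hη)) :
    ∃ f : X.functionField, f ≠ 0 ∧ ∀ x : U, ∃ (V : Y.Opens) (W : U.toScheme.Opens)
      (_ : IsAffineOpen V) (_ : IsAffineOpen W) (_ : x ∈ W) (hW : etaU hη ∈ W) (e : W ≤ φ₀ ⁻¹ᵁ V)
      (β : Γ(X, U.ι ''ᵁ W)), X.presheaf.germ (U.ι ''ᵁ W) (genericPoint X) (etaU_mem hη hW) β = f ∧
        (IsUnit β → (φ₀.appLE V W e).hom.FormallyEtale) := by
  have ch : ∀ x : U, ∃ (V : Y.Opens) (W : U.toScheme.Opens)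
      (_ : IsAffineOpen V) (_ : IsAffineOpen (U.ι ''ᵁ W)) (_ : x ∈ W) (e : W ≤ φ₀ ⁻¹ᵁ V),
      (sH Y V).IsStandardSmoothOfRelativeDimension n ∧
      (sH X (U.ι ''ᵁ W)).IsStandardSmoothOfRelativeDimension n := by
    intro x
    obtain ⟨V, hV, hxV, -, sV⟩ := exists_std n Y (φ₀ x) ⊤ trivial
    obtain ⟨W, hW, hxW, hle, sW⟩ := exists_std n X x (U.ι ''ᵁ (φ₀ ⁻¹ᵁ V)) ⟨x, hxV, rfl⟩
    have hWU : W ≤ U := hle.trans (by rintro _ ⟨z, _, rfl⟩; exact z.2)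
    have e1 : U.ι ''ᵁ (U.ι ⁻¹ᵁ W) = W := by
      rw [Scheme.Hom.image_preimage_eq_opensRange_inf, Scheme.Opens.opensRange_ι, inf_eq_right]; exact hWU
    refine ⟨V, U.ι ⁻¹ᵁ W, hV, by rwa [e1], hxW, ?_, sV, by rwa [e1]⟩
    rintro z hz
    obtain ⟨z', hz', h⟩ := hle hz
    obtain rfl : z' = z := Subtype.ext h
    exact hz'
  have hmem : ∀ {W : U.toScheme.Opens} {x : U} (_ : x ∈ W), etaU hη ∈ W := by
    intro W x hx
    obtain ⟨z, hz, h⟩ := gen_mem X (W := U.ι ''ᵁ W) ⟨x, hx, rfl⟩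
    obtain rfl : z = etaU hη := Subtype.ext h
    exact hz
  have cf := fun (V : Y.Opens) (W : U.toScheme.Opens) (hV : IsAffineOpen V) (hW : IsAffineOpen (U.ι ''ᵁ W))
     (hηW : etaU hη ∈ W) (e : W ≤ φ₀ ⁻¹ᵁ V)
     (sV : (sH Y V).IsStandardSmoothOfRelativeDimension n)
     (sW : (sH X (U.ι ''ᵁ W)).IsStandardSmoothOfRelativeDimension n) => by
    have : Nonempty V := ⟨⟨φ₀ (etaU hη), e hηW⟩⟩
    have : Nonempty (U.ι ''ᵁ W) := ⟨⟨_, etaU_mem hη hηW⟩⟩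
    have hK := functionField_isFractionRing_of_isAffineOpen X (U.ι ''ᵁ W) hW
    exact chart_forms' (n := n) (A := Γ(Y, V)) (B := Γ(X, U.ι ''ᵁ W)) (K := X.functionField) (φ₀.appLE V W e).hom (appLE_sH φ₀ hφ₀over V W e)
      (X.presheaf.germ (U.ι ''ᵁ W) (genericPoint X) (etaU_mem hη hηW)).hom (germ_sH X _ (etaU_mem hη hηW))
      ((rho φ₀ hη).hom.comp (Y.presheaf.germ V (φ₀ (etaU hη)) (mem_of φ₀ e hηW)).hom)
      (congrArg CommRingCat.Hom.hom (germ_rho φ₀ hη V W e hηW)).symm hK sV sW (gform GY V hV) (gform GX _ hW)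
      (form_good _ _ _) (form_good _ _ _)
  obtain ⟨V₀, W₀, hV₀, hW₀, hηW₀, e₀, sV₀, sW₀⟩ := ch (etaU hη)
  obtain ⟨c1, ⟨f, hf, -⟩, c3⟩ := cf V₀ W₀ hV₀ hW₀ hηW₀ e₀ sV₀ sW₀
  have c4 := c3 (by
    intro t
    obtain ⟨t, rfl⟩ := hsurj t
    obtain ⟨a, s, hs, h⟩ := frac_stalk Y V₀ hV₀ (φ₀ (etaU hη)) (mem_of φ₀ e₀ hηW₀) t
    refine ⟨a, s, (hs.map (rho φ₀ hη).hom).ne_zero, ?_⟩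
    have := congrArg (rho φ₀ hη).hom h
    rw [map_mul] at this
    exact this)
  refine ⟨X.presheaf.germ (U.ι ''ᵁ W₀) (genericPoint X) (etaU_mem hη hηW₀) f, ?_, ?_⟩
  · intro h0
    apply c4
    rw [hf]
    erw [h0]
    exact zero_smul _ _
  intro x
  obtain ⟨V, W, hV, hW, hxW, e, sV, sW⟩ := ch x
  have hηW := hmem hxW
  obtain ⟨-, ⟨β, hβ, het⟩, -⟩ := cf V W hV hW hηW e sV sW
  refine ⟨V, W, hV, ?_, hxW, hηW, e, β, ?_, het⟩
  · exact (Scheme.Hom.isAffineOpen_iff_of_isOpenImmersion U.ι).mp hW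
  have i1 := form_indep GY V V₀ hV hV₀ (φ₀ (etaU hη)) (mem_of φ₀ e hηW) (mem_of φ₀ e₀ hηW₀) (rho φ₀ hη).hom (lK X)
    (rho_sH φ₀ hη hφ₀over V W e hηW) (rho_sH φ₀ hη hφ₀over V₀ W₀ e₀ hηW₀)
  have i2 := form_indep GX (U.ι ''ᵁ W) (U.ι ''ᵁ W₀) hW hW₀ (genericPoint X) (etaU_mem hη hηW) (etaU_mem hη hηW₀) (RingHom.id _) (lK X)
    (germ_sH X _ (etaU_mem hη hηW)) (germ_sH X _ (etaU_mem hη hηW₀))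
  erw [i1, i2, hf] at hβ
  exact (ext_smul_cancel _ c1 _ _ hβ).symm
end BG

namespace BG

theorem proj_proper (Y : Scheme.{0}) (h : IsProjectiveComplexVariety Y) : ∃ p : Y ⟶ Spec ℂRing, IsProper p := by
  obtain ⟨N, i, hi⟩ := h
  let 𝒜 := MvPolynomial.homogeneousSubmodule (Fin (N + 1)) ℂ
  have : IsScalarTower ℂ (𝒜 0) (MvPolynomial (Fin (N + 1)) ℂ) := ⟨fun a b c => smul_mul_assoc a (b : MvPolynomial (Fin (N + 1)) ℂ) c⟩
  have : Algebra.FiniteType (𝒜 0) (MvPolynomial (Fin (N + 1)) ℂ) :=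
    Algebra.FiniteType.of_restrictScalars_finiteType ℂ _ _
  have hb : Function.Bijective (algebraMap ℂ (𝒜 0)) := by
    constructor
    · intro a b hab
      exact MvPolynomial.C_injective (Fin (N + 1)) ℂ (congrArg Subtype.val hab)
    · rintro ⟨x, hx⟩
      have hx' : x ∈ MvPolynomial.homogeneousSubmodule (Fin (N + 1)) ℂ 0 := hx
      rw [MvPolynomial.homogeneousSubmodule_zero] at hx'
      obtain ⟨c, hc⟩ := Submodule.mem_one.mp hx'
      exact ⟨c, Subtype.ext hc⟩
  let e := RingEquiv.ofBijective _ hb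
  have hp : IsProper (Proj.toSpecZero 𝒜) := inferInstance
  have : IsIso (Spec.map (CommRingCat.ofHom (algebraMap ℂ (𝒜 0)))) := by
    have : IsIso (CommRingCat.ofHom (algebraMap ℂ (𝒜 0))) :=
      (inferInstance : IsIso e.toCommRingCatIso.hom)
    infer_instance
  let j : Y ⟶ Proj 𝒜 := i
  have : IsClosedImmersion j := hi
  exact ⟨j ≫ Proj.toSpecZero 𝒜 ≫ Spec.map (CommRingCat.ofHom (algebraMap ℂ (𝒜 0))), inferInstance⟩

theorem proj_sep (Y : Scheme.{0}) (h : IsProjectiveComplexVariety Y) : Y.IsSeparated := by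
  obtain ⟨p, hp⟩ := proj_proper Y h
  have : IsSeparated (p ≫ Limits.terminal.from _) := inferInstance
  rw [Limits.terminal.comp_from] at this
  exact ⟨this⟩

theorem max_le {X Y : Scheme.{0}}
    [X.Over (Spec ℂRing)] [Y.Over (Spec ℂRing)]
    [IsIntegral X] [Y.IsSeparated]
    (U : X.Opens) (hUdense : Dense (U : Set X))
    (φ₀ : U.toScheme ⟶ Y)
    (hφ₀over : φ₀ ≫ (Y ↘ Spec ℂRing) = U.ι ≫ (X ↘ Spec ℂRing))
    (hUmax : ∀ (U' : X.Opens) (ψ : U'.toScheme ⟶ Y),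
      ψ ≫ (Y ↘ Spec ℂRing) = U'.ι ≫ (X ↘ Spec ℂRing) →
      ∀ hle : U ≤ U', X.homOfLE hle ≫ ψ = φ₀ → U' ≤ U)
    (f : X.PartialMap Y) (hf : f.equiv ⟨U, hUdense, φ₀⟩) : f.domain ≤ U := by
  let Φ : X.PartialMap Y := ⟨U, hUdense, φ₀⟩
  have : Φ.IsOver (Spec ℂRing) := ⟨hφ₀over⟩
  have h1 : f.toRationalMap = Φ.toRationalMap := Scheme.PartialMap.toRationalMap_eq_iff.mpr hf
  have h2 : f.domain ≤ Φ.toRationalMap.toPartialMap.domain := by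
    have := f.le_domain_toRationalMap
    rw [h1] at this
    exact this
  have h3 : Φ.toRationalMap.toPartialMap.IsOver (Spec ℂRing) := inferInstance
  exact h2.trans (hUmax _ Φ.toRationalMap.toPartialMap.hom h3.1 Φ.le_domain_toRationalMap
    Φ.toPartialMap_toRationalMap_restrict)

theorem spec_dominant {A B : Type} [CommRing A] [CommRing B] (f : A →+* B) (hf : Function.Injective f) :
    IsDominant (Spec.map (CommRingCat.ofHom f)) := by
  constructor
  have := (PrimeSpectrum.denseRange_comap_iff_ker_le_nilRadical f).2
    (by rw [(RingHom.injective_iff_ker_eq_bot f).1 hf]; exact bot_le)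
  exact this

theorem lift_dvr {Y : Scheme.{0}} (h : IsProjectiveComplexVariety Y) (O K : Type) [CommRing O] [IsDomain O]
    [IsDiscreteValuationRing O] [Field K] [Algebra O K]
    [IsFractionRing O K] (g : Spec (.of K) ⟶ Y) :
    ∃ l : Spec (.of O) ⟶ Y, Spec.map (CommRingCat.ofHom (algebraMap O K)) ≫ l = g := by
  obtain ⟨p, hp⟩ := proj_proper Y h
  obtain ⟨σ, hσ⟩ := Spec.map_surjective (g ≫ p)
  have hinj := IsFractionRing.injective O K
  let e := RingEquiv.ofBijective (algebraMap O K).rangeRestrict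
    ⟨fun a b h => hinj (congrArg Subtype.val h), (algebraMap O K).rangeRestrict_surjective⟩
  let τ : ℂ →+* O := (e.symm : _ →+* O).comp (RingHom.codRestrict σ.hom (algebraMap O K).range
    (fun c => divisible_dvr O K σ.hom c))
  have hτ : CommRingCat.ofHom τ ≫ CommRingCat.ofHom (algebraMap O K) = σ := by
    ext c
    exact congrArg Subtype.val (e.apply_symm_apply _)
  have sq : CommSq g (Spec.map (CommRingCat.ofHom (algebraMap O K))) p (Spec.map (CommRingCat.ofHom τ)) :=
    ⟨by rw [← Spec.map_comp, hτ, hσ]⟩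
  have hval : ValuativeCriterion.Existence p := by
    have h1 : UniversallyClosed p := inferInstance
    rw [UniversallyClosed.eq_valuativeCriterion] at h1
    exact h1.1
  obtain ⟨⟨l⟩⟩ := hval ⟨O, K, g, Spec.map (CommRingCat.ofHom τ), sq⟩
  exact ⟨l.l, l.fac_left⟩

theorem dvr_mem {X Y : Scheme.{0}}
    [X.Over (Spec ℂRing)] [Y.Over (Spec ℂRing)]
    [IsIntegral X] [LocallyOfFiniteType (Y ↘ Spec ℂRing)]
    (hYproj : IsProjectiveComplexVariety Y)
    (U : X.Opens) (hUdense : Dense (U : Set X))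
    (φ₀ : U.toScheme ⟶ Y)
    (hφ₀over : φ₀ ≫ (Y ↘ Spec ℂRing) = U.ι ≫ (X ↘ Spec ℂRing))
    (hUmax : ∀ (U' : X.Opens) (ψ : U'.toScheme ⟶ Y),
      ψ ≫ (Y ↘ Spec ℂRing) = U'.ι ≫ (X ↘ Spec ℂRing) →
      ∀ hle : U ≤ U', X.homOfLE hle ≫ ψ = φ₀ → U' ≤ U)
    (x : X) (hx : IsDiscreteValuationRing (X.presheaf.stalk x)) : x ∈ U := by
  have := proj_sep Y hYproj
  let Φ : X.PartialMap Y := ⟨U, hUdense, φ₀⟩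
  have hη : genericPoint X ∈ U := by
    obtain ⟨z, hz⟩ := hUdense.nonempty
    exact gen_mem X hz
  obtain ⟨l, hl⟩ := lift_dvr hYproj (X.presheaf.stalk x) X.functionField (Φ.fromSpecStalkOfMem hη)
  have hsp : genericPoint X ⤳ x := (genericPoint_spec X).specializes trivial
  have hl2 : Spec.map (X.presheaf.stalkSpecializes hsp) ≫ l = Φ.fromSpecStalkOfMem hη := hl
  have hdom : IsDominant (Spec.map (X.presheaf.stalkSpecializes hsp)) :=
    spec_dominant (algebraMap (X.presheaf.stalk x) X.functionField) (IsFractionRing.injective _ _)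
  have hover : l ≫ (Y ↘ Spec ℂRing) = X.fromSpecStalk x ≫ (X ↘ Spec ℂRing) := by
    apply ext_of_isDominant (Spec.map (X.presheaf.stalkSpecializes hsp))
    rw [reassoc_of% hl2, Scheme.SpecMap_stalkSpecializes_fromSpecStalk_assoc,
      Scheme.PartialMap.fromSpecStalkOfMem, Category.assoc]
    change _ ≫ φ₀ ≫ _ = _
    rw [hφ₀over, Scheme.Opens.fromSpecStalkOfMem_ι_assoc]
  let f := Scheme.PartialMap.ofFromSpecStalk (X ↘ Spec ℂRing) (Y ↘ Spec ℂRing) l hover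
  have hxf : x ∈ f.domain := Scheme.PartialMap.mem_domain_ofFromSpecStalk _ _ _ _
  refine max_le U hUdense φ₀ hφ₀over hUmax f ?_ hxf
  have hηf : genericPoint X ∈ f.domain := gen_mem X hxf
  refine Scheme.PartialMap.equiv_of_fromSpecStalkOfMem_eq f Φ hηf hη ?_
  rw [← hl2, ← Scheme.PartialMap.fromSpecStalkOfMem_ofFromSpecStalk (X ↘ Spec ℂRing) (Y ↘ Spec ℂRing) l hover]
  change f.fromSpecStalkOfMem hηf = _ ≫ f.fromSpecStalkOfMem hxf
  rw [Scheme.PartialMap.fromSpecStalkOfMem, Scheme.PartialMap.fromSpecStalkOfMem, ← Category.assoc]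
  congr 1
  rw [← cancel_mono f.domain.ι, Category.assoc, Scheme.Opens.fromSpecStalkOfMem_ι,
    Scheme.Opens.fromSpecStalkOfMem_ι, Scheme.SpecMap_stalkSpecializes_fromSpecStalk]
end BG

namespace BG

theorem local_sec (n : ℕ) {X : Scheme.{0}} [X.Over (Spec ℂRing)] [IsIntegral X]
    [SmoothOfRelativeDimension n (X ↘ Spec ℂRing)] (f : X.functionField)
    (hf : ∀ x : X, IsDiscreteValuationRing (X.presheaf.stalk x) →
      ∃ r : X.presheaf.stalk x, algebraMap (X.presheaf.stalk x) X.functionField r = f) (x : X) :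
    ∃ (W : X.Opens) (_ : x ∈ W) (h : genericPoint X ∈ W) (s : Γ(X, W)), X.presheaf.germ W (genericPoint X) h s = f := by
  obtain ⟨W, hW, hxW, -, sW⟩ := exists_std n X x ⊤ trivial
  have : Nonempty W := ⟨⟨x, hxW⟩⟩
  suffices h : f ∈ (algebraMap Γ(X, W) X.functionField).range by
    obtain ⟨s, hs⟩ := h
    exact ⟨W, hxW, gen_mem X hxW, s, hs⟩
  by_contra hcon
  have hfrac := functionField_isFractionRing_of_isAffineOpen X W hW
  have hnorm : IsIntegrallyClosed Γ(X, W) ∧ IsNoetherianRing Γ(X, W) := by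
    let := (sH X W).toAlgebra
    have : Algebra.IsStandardSmoothOfRelativeDimension n ℂ Γ(X, W) := sW
    have : Algebra.IsStandardSmooth ℂ Γ(X, W) := Algebra.IsStandardSmoothOfRelativeDimension.isStandardSmooth n
    refine ⟨normal_of_smooth ℂ Γ(X, W), ?_⟩
    exact Algebra.FiniteType.isNoetherianRing ℂ Γ(X, W)
  have := hnorm.1
  have := hnorm.2
  obtain ⟨P, hP, h1, h2⟩ := hartogs Γ(X, W) X.functionField f hcon
  let y : PrimeSpectrum Γ(X, W) := ⟨P, hP⟩
  have hy : hW.fromSpec y ∈ W := (hW.isoSpec.inv _).2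
  let z : W := ⟨hW.fromSpec y, hy⟩
  let alg : Algebra Γ(X, W) (X.presheaf.stalk (z : X)) := TopCat.Presheaf.algebra_section_stalk X.presheaf z
  have hloc : IsLocalization.AtPrime (X.presheaf.stalk (z : X)) P := hW.isLocalization_stalk' y hy
  have htow : IsScalarTower Γ(X, W) (X.presheaf.stalk (z : X)) X.functionField := functionField_isScalarTower X W z
  have hd := h2 (X.presheaf.stalk (z : X))
  obtain ⟨r, hr⟩ := hf z hd
  obtain ⟨⟨a, s⟩, h⟩ := IsLocalization.surj P.primeCompl r
  apply h1 s s.2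
  refine ⟨a, ?_⟩
  have := congrArg (algebraMap (X.presheaf.stalk (z : X)) X.functionField) h
  rw [map_mul, hr, ← IsScalarTower.algebraMap_apply, ← IsScalarTower.algebraMap_apply] at this
  rw [mul_comm]
  exact this.symm

theorem global_sec {X : Scheme.{0}} [IsIntegral X] (f : X.functionField)
    (hf : ∀ x : X, ∃ (W : X.Opens) (_ : x ∈ W) (h : genericPoint X ∈ W) (s : Γ(X, W)),
      X.presheaf.germ W (genericPoint X) h s = f) :
    ∃ s : Γ(X, ⊤), X.presheaf.germ ⊤ (genericPoint X) trivial s = f := by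
  choose W hxW hη s hs using hf
  obtain ⟨t, ht, -⟩ := TopCat.Sheaf.existsUnique_gluing' X.sheaf W ⊤ (fun i => homOfLE le_top)
    (fun x _ => TopologicalSpace.Opens.mem_iSup.2 ⟨x, hxW x⟩) s (by
      intro i j
      apply germ_injective_of_isIntegral X (genericPoint X) (U := W i ⊓ W j) ⟨hη i, hη j⟩
      refine (X.presheaf.germ_res_apply (TopologicalSpace.Opens.infLELeft (W i) (W j)) (genericPoint X) ⟨hη i, hη j⟩ (s i)).trans ?_
      refine Eq.trans ?_ (X.presheaf.germ_res_apply (TopologicalSpace.Opens.infLERight (W i) (W j)) (genericPoint X) ⟨hη i, hη j⟩ (s j)).symm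
      exact (hs i).trans (hs j).symm)
  refine ⟨t, ?_⟩
  rw [← hs (genericPoint X), ← ht (genericPoint X)]
  exact (X.presheaf.germ_res_apply (homOfLE le_top : W (genericPoint X) ⟶ ⊤) (genericPoint X) (hη _) t).symm

theorem unit_sec {X : Scheme.{0}} [IsIntegral X] (hX : IsProjectiveComplexVariety X) (s : Γ(X, ⊤))
    (hs : X.presheaf.germ ⊤ (genericPoint X) trivial s ≠ 0) : IsUnit s := by
  obtain ⟨p, hp⟩ := proj_proper X hX
  have hF := isField_of_universallyClosed ℂ p
  let := hF.toField
  have : s ≠ 0 := by rintro rfl; exact hs (map_zero _)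
  obtain ⟨t, ht⟩ := hF.mul_inv_cancel this
  exact IsUnit.of_mul_eq_one t ht

theorem chart_etale (n : ℕ) (X Y : Scheme.{0})
    [X.Over (Spec ℂRing)] [Y.Over (Spec ℂRing)]
    [IsIntegral X] [IsIntegral Y]
    [SmoothOfRelativeDimension n (X ↘ Spec ℂRing)]
    [SmoothOfRelativeDimension n (Y ↘ Spec ℂRing)]
    (hXproj : IsProjectiveComplexVariety X) (hYproj : IsProjectiveComplexVariety Y)
    (GX : GaugeForm ℂRing X n) (GY : GaugeForm ℂRing Y n)
    (U : X.Opens) (hUdense : Dense (U : Set X))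
    (φ₀ : U.toScheme ⟶ Y)
    (hφ₀over : φ₀ ≫ (Y ↘ Spec ℂRing) = U.ι ≫ (X ↘ Spec ℂRing))
    (hUmax : ∀ (U' : X.Opens) (ψ : U'.toScheme ⟶ Y),
      ψ ≫ (Y ↘ Spec ℂRing) = U'.ι ≫ (X ↘ Spec ℂRing) →
      ∀ hle : U ≤ U', X.homOfLE hle ≫ ψ = φ₀ → U' ≤ U)
    (hη : genericPoint X ∈ U)
    (hsurj : Function.Surjective (rho φ₀ hη)) (x : U) :
    ∃ (V : Y.Opens) (W : U.toScheme.Opens)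
      (_ : IsAffineOpen V) (_ : IsAffineOpen W) (_ : x ∈ W) (e : W ≤ φ₀ ⁻¹ᵁ V),
        (φ₀.appLE V W e).hom.FormallyEtale := by
  have hsm : Smooth (Y ↘ Spec ℂRing) := SmoothOfRelativeDimension.smooth n _
  obtain ⟨f, hf0, hf⟩ := charts n X Y GX GY U φ₀ hφ₀over hη hsurj
  have h1 : ∀ x : X, IsDiscreteValuationRing (X.presheaf.stalk x) →
      ∃ r : X.presheaf.stalk x, algebraMap (X.presheaf.stalk x) X.functionField r = f := by
    intro x hx
    have hxU := dvr_mem hYproj U hUdense φ₀ hφ₀over hUmax x hx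
    obtain ⟨V, W, hV, hW, hxW, hηW, e, β, hβ, -⟩ := hf ⟨x, hxU⟩
    have hxW' : x ∈ U.ι ''ᵁ W := ⟨_, hxW, rfl⟩
    have : Nonempty (U.ι ''ᵁ W) := ⟨⟨x, hxW'⟩⟩
    refine ⟨X.presheaf.germ (U.ι ''ᵁ W) x hxW' β, ?_⟩
    rw [Scheme.algebraMap_germ_eq_germToFunctionField]
    exact hβ
  obtain ⟨s, hs⟩ := global_sec f (local_sec n f h1)
  have hu := unit_sec hXproj s (by rw [hs]; exact hf0)
  obtain ⟨V, W, hV, hW, hxW, hηW, e, β, hβ, het⟩ := hf x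
  refine ⟨V, W, hV, hW, hxW, e, het ?_⟩
  have : β = X.presheaf.map (homOfLE (le_top : U.ι ''ᵁ W ≤ ⊤)).op s := by
    apply germ_injective_of_isIntegral X (genericPoint X) (etaU_mem hη hηW)
    rw [TopCat.Presheaf.germ_res_apply, hβ]
    exact hs.symm
  rw [this]
  exact hu.map (X.presheaf.map (homOfLE (le_top : U.ι ''ᵁ W ≤ ⊤)).op).hom
end BG

namespace BG

theorem gen_sp (Z : Scheme.{0}) [IsIntegral Z] (z : Z) : genericPoint Z ⤳ z :=
  (genericPoint_spec Z).specializes trivial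

/-- The map from a local ring of the target to the function field of the source. -/
noncomputable def qmap {Z Y : Scheme.{0}} [IsIntegral Z] (f : Z ⟶ Y) (y : Y) (h : f (genericPoint Z) ⤳ y) :
    Y.presheaf.stalk y ⟶ Z.functionField :=
  Y.presheaf.stalkSpecializes h ≫ f.stalkMap (genericPoint Z)

theorem qmap_eq {Z Y : Scheme.{0}} [IsIntegral Z] (f : Z ⟶ Y) (z : Z) (h : f (genericPoint Z) ⤳ f z) :
    qmap f (f z) h = f.stalkMap z ≫ Z.presheaf.stalkSpecializes (gen_sp Z z) :=
  Scheme.Hom.stalkSpecializes_stalkMap f _ _ (gen_sp Z z)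

theorem spz_inj {Z : Scheme.{0}} [IsIntegral Z] (z : Z) :
    Function.Injective (Z.presheaf.stalkSpecializes (gen_sp Z z)) :=
  IsFractionRing.injective (Z.presheaf.stalk z) Z.functionField

theorem stalk_surj {Z Y : Scheme.{0}} [IsIntegral Z] (f : Z ⟶ Y) [Flat f]
    (hs : Function.Surjective (f.stalkMap (genericPoint Z))) (z : Z) :
    Function.Surjective (f.stalkMap z) := by
  have hsp : f (genericPoint Z) ⤳ f z := f.base.hom.map_specializes (gen_sp Z z)
  have hq := qmap_eq f z hsp
  have hq' : ∀ a, Z.presheaf.stalkSpecializes (gen_sp Z z) (f.stalkMap z a) = qmap f (f z) hsp a :=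
    fun a => (congrArg (fun g => g.hom a) hq).symm
  refine surj_of_flat (Y.presheaf.stalk (f z)) (Z.presheaf.stalk z) Z.functionField (f.stalkMap z).hom
    (Z.presheaf.stalkSpecializes (gen_sp Z z)).hom (spz_inj z) (Flat.stalkMap f z) ?_
  intro t
  obtain ⟨u, rfl⟩ := hs t
  obtain ⟨_, ⟨V, hV, rfl⟩, hyV, -⟩ :=
    Y.isBasis_affineOpens.exists_subset_of_mem_open (Set.mem_univ (f z)) isOpen_univ
  have hηV : f (genericPoint Z) ∈ V := hsp.mem_open V.2 hyV
  obtain ⟨a, s, hsu, has⟩ := frac_stalk Y V hV _ hηV u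
  have key : ∀ b : Γ(Y, V), Z.presheaf.stalkSpecializes (gen_sp Z z) (f.stalkMap z (Y.presheaf.germ V (f z) hyV b))
      = f.stalkMap (genericPoint Z) (Y.presheaf.germ V _ hηV b) := by
    intro b
    rw [hq']
    exact congrArg (fun g => f.stalkMap (genericPoint Z) (g.hom b)) (Y.presheaf.germ_stalkSpecializes hyV hsp)
  refine ⟨Y.presheaf.germ V (f z) hyV a, Y.presheaf.germ V (f z) hyV s, ?_, ?_⟩
  · refine fun h => ?_
    have h2 := (key s).symm.trans h
    exact (hsu.map (f.stalkMap (genericPoint Z)).hom).ne_zero h2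
  · refine (congrArg _ (key s)).trans (Eq.trans ?_ (key a).symm)
    rw [← has]
    exact (map_mul (f.stalkMap (genericPoint Z)).hom u _).symm

theorem flat_inj (A B : Type) [CommRing A] [CommRing B] [IsLocalRing A] [IsLocalRing B] (θ : A →+* B)
    [IsLocalHom θ] (hflat : θ.Flat) : Function.Injective θ := by
  algebraize [θ]
  have : IsLocalHom (algebraMap A B) := ‹IsLocalHom θ›
  have : Module.FaithfullyFlat A B := Module.FaithfullyFlat.of_flat_of_isLocalHom
  exact FaithfulSMul.algebraMap_injective A B

theorem stalk_bij {Z Y : Scheme.{0}} [IsIntegral Z] (f : Z ⟶ Y) [Flat f]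
    (hs : Function.Surjective (f.stalkMap (genericPoint Z))) (z : Z) :
    IsIso (f.stalkMap z) := by
  have hfl := Flat.stalkMap f z
  have : IsLocalHom (f.stalkMap z).hom := f.toLRSHom.prop z
  refine (ConcreteCategory.isIso_iff_bijective (f.stalkMap z)).2 ⟨?_, stalk_surj f hs z⟩
  exact flat_inj _ _ (f.stalkMap z).hom hfl

theorem exists_g {Z Y : Scheme.{0}} [IsIntegral Z] (f : Z ⟶ Y) [Flat f]
    (hs : Function.Surjective (f.stalkMap (genericPoint Z))) (z : Z) (y : Y) (hy : f z = y)
    (h : f (genericPoint Z) ⤳ y) :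
    Function.Injective (qmap f y h) ∧
    ∃ g : Spec (Y.presheaf.stalk y) ⟶ Z, g (IsLocalRing.closedPoint (Y.presheaf.stalk y)) = z ∧
      Spec.map (qmap f y h) ≫ g = Z.fromSpecStalk (genericPoint Z) := by
  subst hy
  have := stalk_bij f hs z
  constructor
  · rw [qmap_eq]
    exact (spz_inj z).comp ((ConcreteCategory.isIso_iff_bijective (f.stalkMap z)).1 this).1
  · refine ⟨Spec.map (inv (f.stalkMap z)) ≫ Z.fromSpecStalk z, ?_, ?_⟩
    · refine (Scheme.Hom.comp_apply _ _ _).trans ?_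
      have : IsLocalHom (inv (f.stalkMap z)).hom := inferInstance
      refine (congrArg _ (IsLocalRing.comap_closedPoint (inv (f.stalkMap z)).hom)).trans ?_
      exact Scheme.fromSpecStalk_closedPoint
    · rw [qmap_eq, ← Spec.map_comp_assoc, IsIso.inv_hom_id_assoc, Scheme.SpecMap_stalkSpecializes_fromSpecStalk]

theorem open_imm {Z Y : Scheme.{0}} [IsIntegral Z] [IsIntegral Y] [Z.IsSeparated] (f : Z ⟶ Y) [Flat f]
    [LocallyOfFinitePresentation f]
    (hs : Function.Surjective (f.stalkMap (genericPoint Z))) : IsOpenImmersion f := by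
  have hinj : Function.Injective f := by
    intro z w hzw
    have h : f (genericPoint Z) ⤳ f w := f.base.hom.map_specializes (gen_sp Z w)
    obtain ⟨hi, g₁, h₁, h₁'⟩ := exists_g f hs z (f w) hzw h
    obtain ⟨-, g₂, h₂, h₂'⟩ := exists_g f hs w (f w) rfl h
    have hd : IsDominant (Spec.map (qmap f (f w) h)) := spec_dominant (qmap f (f w) h).hom hi
    have := ext_of_isDominant (f := g₁) (g := g₂) (Spec.map (qmap f (f w) h)) (h₁'.trans h₂'.symm)
    subst this
    exact h₁.symm.trans h₂
  have hemb : Topology.IsEmbedding f :=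
    (Topology.IsOpenEmbedding.of_continuous_injective_isOpenMap f.continuous hinj f.isOpenMap).isEmbedding
  have : IsPreimmersion f := { stalkMap_surjective := stalk_surj f hs, isEmbedding := hemb }
  exact IsOpenImmersion.of_flat_of_mono f

theorem fp_appLE {U Y S : Scheme.{0}} (φ : U ⟶ Y) (p : Y ⟶ S) [LocallyOfFiniteType p]
    [LocallyOfFinitePresentation (φ ≫ p)] [IsAffine S] (V : Y.Opens) (W : U.Opens) (hV : IsAffineOpen V)
    (hW : IsAffineOpen W) (e : W ≤ φ ⁻¹ᵁ V) : (φ.appLE V W e).hom.FinitePresentation := by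
  have h1 := Scheme.Hom.appLE_comp_appLE φ p ⊤ V W (top_le' _ _) e
  refine RingHom.FinitePresentation.of_comp_finiteType (p.appLE ⊤ V (top_le' _ _)).hom ?_
    (p.finiteType_appLE (isAffineOpen_top S) hV _)
  have h2 := (φ ≫ p).finitePresentation_appLE (isAffineOpen_top S) hW (top_le' _ _)
  rw [← h1] at h2
  exact h2

theorem etale_of {A B : Type} [CommRing A] [CommRing B] (φ : A →+* B) (h : φ.FormallyEtale)
    (h2 : φ.FinitePresentation) : φ.Etale := by
  algebraize [φ]
  exact (RingHom.etale_algebraMap).2 (by constructor <;> infer_instance)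

theorem main_imm (n : ℕ) (X Y : Scheme.{0})
    [X.Over (Spec ℂRing)] [Y.Over (Spec ℂRing)]
    [IsIntegral X] [IsIntegral Y]
    [SmoothOfRelativeDimension n (X ↘ Spec ℂRing)]
    [SmoothOfRelativeDimension n (Y ↘ Spec ℂRing)]
    (hXproj : IsProjectiveComplexVariety X) (hYproj : IsProjectiveComplexVariety Y)
    (GX : GaugeForm ℂRing X n) (GY : GaugeForm ℂRing Y n)
    (U : X.Opens) (hUdense : Dense (U : Set X))
    (φ₀ : U.toScheme ⟶ Y)
    (hφ₀over : φ₀ ≫ (Y ↘ Spec ℂRing) = U.ι ≫ (X ↘ Spec ℂRing))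
    (hUmax : ∀ (U' : X.Opens) (ψ : U'.toScheme ⟶ Y),
      ψ ≫ (Y ↘ Spec ℂRing) = U'.ι ≫ (X ↘ Spec ℂRing) →
      ∀ hle : U ≤ U', X.homOfLE hle ≫ ψ = φ₀ → U' ≤ U)
    (hη : genericPoint X ∈ U)
    (hsurj : Function.Surjective (φ₀.stalkMap (etaU hη))) : IsOpenImmersion φ₀ := by
  have hsm : Smooth (Y ↘ Spec ℂRing) := SmoothOfRelativeDimension.smooth n _
  have hsmX : Smooth (X ↘ Spec ℂRing) := SmoothOfRelativeDimension.smooth n _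
  have hlfp : LocallyOfFinitePresentation (φ₀ ≫ (Y ↘ Spec ℂRing)) := by
    rw [hφ₀over]; infer_instance
  have hrho : Function.Surjective (rho φ₀ hη) := by
    have h2 : Function.Surjective (U.stalkIso (etaU hη)).hom :=
      ((ConcreteCategory.isIso_iff_bijective (U.stalkIso (etaU hη)).hom).1 inferInstance).2
    exact h2.comp hsurj
  have het : Etale φ₀ := by
    rw [HasRingHomProperty.iff_exists_appLE (P := @Etale)
      (RingHom.Etale.stableUnderComposition.stableUnderCompositionWithLocalizationAway (RingHom.Etale.propertyIsLocal.HoldsForLocalizationAway RingHom.Etale.containsIdentities)).left]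
    intro x
    obtain ⟨V, W, hV, hW, hxW, e, h⟩ := chart_etale n X Y hXproj hYproj GX GY U hUdense φ₀ hφ₀over
      hUmax hη hrho x
    refine ⟨⟨V, hV⟩, ⟨W, hW⟩, hxW, e, ?_⟩
    have h2 := fp_appLE φ₀ (Y ↘ Spec ℂRing) V W hV hW e
    change (φ₀.appLE V W e).hom.Etale
    exact etale_of _ h h2
  have : Nonempty U := ⟨⟨_, hη⟩⟩
  have := proj_sep X hXproj
  have hgen : genericPoint U.toScheme = etaU hη := by
    apply U.ι.isOpenEmbedding.injective
    exact genericPoint_eq_of_isOpenImmersion U.ι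
  have hsep : U.toScheme.IsSeparated := by
    have : IsSeparated (U.ι ≫ Limits.terminal.from _) := inferInstance
    rw [Limits.terminal.comp_from] at this
    exact ⟨this⟩
  have : Flat φ₀ := inferInstance
  have : IsIntegral U.toScheme := inferInstance
  have : LocallyOfFinitePresentation φ₀ := inferInstance
  apply open_imm φ₀
  rw [hgen]
  exact hsurj
end BG

namespace BG

theorem half (n : ℕ) (X Y : Scheme.{0})
    [X.Over (Spec ℂRing)] [Y.Over (Spec ℂRing)]
    [IsIntegral X] [IsIntegral Y]
    [SmoothOfRelativeDimension n (X ↘ Spec ℂRing)]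
    [SmoothOfRelativeDimension n (Y ↘ Spec ℂRing)]
    (hXproj : IsProjectiveComplexVariety X) (hYproj : IsProjectiveComplexVariety Y)
    (GX : GaugeForm ℂRing X n) (GY : GaugeForm ℂRing Y n)
    (U : X.Opens) (hUdense : Dense (U : Set X))
    (φ₀ : U.toScheme ⟶ Y)
    (hφ₀over : φ₀ ≫ (Y ↘ Spec ℂRing) = U.ι ≫ (X ↘ Spec ℂRing))
    (hUmax : ∀ (U' : X.Opens) (ψ : U'.toScheme ⟶ Y),
      ψ ≫ (Y ↘ Spec ℂRing) = U'.ι ≫ (X ↘ Spec ℂRing) →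
      ∀ hle : U ≤ U', X.homOfLE hle ≫ ψ = φ₀ → U' ≤ U)
    (V : Y.Opens) (hVdense : Dense (V : Set Y))
    (ψ₀ : V.toScheme ⟶ X)
    (hψ₀over : ψ₀ ≫ (X ↘ Spec ℂRing) = V.ι ≫ (Y ↘ Spec ℂRing))
    (hVmax : ∀ (V' : Y.Opens) (χ : V'.toScheme ⟶ X),
      χ ≫ (X ↘ Spec ℂRing) = V'.ι ≫ (Y ↘ Spec ℂRing) →
      ∀ hle : V ≤ V', Y.homOfLE hle ≫ χ = ψ₀ → V' ≤ V)
    (hbir : ∃ (W : X.Opens) (hWU : W ≤ U) (χ : W.toScheme ⟶ V.toScheme),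
      Dense (W : Set X) ∧ χ ≫ V.ι = X.homOfLE hWU ≫ φ₀ ∧ χ ≫ ψ₀ = W.ι) :
    IsOpenImmersion φ₀ ∧ Set.range φ₀ ⊆ (V : Set Y) ∧
    (∃ (W : Y.Opens) (hWV : W ≤ V) (χ : W.toScheme ⟶ U.toScheme),
      Dense (W : Set Y) ∧ χ ≫ U.ι = Y.homOfLE hWV ≫ ψ₀ ∧ χ ≫ φ₀ = W.ι) := by
  obtain ⟨W, hWU, χ, hWd, h1, h2⟩ := hbir
  have hXs := proj_sep X hXproj
  obtain ⟨w, hw⟩ := hWd.nonempty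
  have hηW : genericPoint X ∈ W := gen_mem X hw
  have hη : genericPoint X ∈ U := hWU hηW
  have hsurj : Function.Surjective (φ₀.stalkMap (etaU hη)) := by
    have i1 : SurjectiveOnStalks (χ ≫ ψ₀) := by rw [h2]; infer_instance
    have i2 : SurjectiveOnStalks χ := SurjectiveOnStalks.of_comp χ ψ₀
    have i3 : SurjectiveOnStalks (X.homOfLE hWU ≫ φ₀) := by rw [← h1]; infer_instance
    have h3 := (X.homOfLE hWU ≫ φ₀).stalkMap_surjective (etaU hηW)
    rw [Scheme.Hom.stalkMap_comp] at h3
    have h4 : Function.Bijective ((X.homOfLE hWU).stalkMap (etaU hηW)) :=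
      (ConcreteCategory.isIso_iff_bijective _).1 inferInstance
    have h5 : X.homOfLE hWU (etaU hηW) = etaU hη := by
      apply U.ι.isOpenEmbedding.injective
      exact (Scheme.Hom.comp_apply _ _ _).symm.trans (congrArg (fun g : W.toScheme ⟶ X => g (etaU hηW)) (X.homOfLE_ι hWU))
    rw [← h5]
    intro t
    obtain ⟨a, ha⟩ := h3 ((X.homOfLE hWU).stalkMap (etaU hηW) t)
    exact ⟨a, h4.1 ha⟩
  have himm := main_imm n X Y hXproj hYproj GX GY U hUdense φ₀ hφ₀over hUmax hη hsurj
  have hirr : ∀ (T : Y.Opens) (y : Y), y ∈ T → Dense (T : Set Y) := fun T y hy => T.2.dense ⟨y, hy⟩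
  let p := X.homOfLE hWU ≫ φ₀
  have hp : p = X.homOfLE hWU ≫ φ₀ := rfl
  let W' : Y.Opens := p.opensRange
  have hW'd : Dense (W' : Set Y) := hirr W' (p (etaU hηW)) ⟨_, rfl⟩
  have hV1d : Dense (φ₀.opensRange : Set Y) := hirr _ (φ₀ (etaU hη)) ⟨_, rfl⟩
  have hW'V : W' ≤ V := by
    rintro _ ⟨z, rfl⟩
    have : p = χ ≫ V.ι := h1.symm
    rw [this]
    have h6 : V.ι (χ z) ∈ V := (χ z).2
    exact h6
  have hW'1 : W' ≤ φ₀.opensRange := by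
    rintro _ ⟨z, rfl⟩
    exact ⟨X.homOfLE hWU z, rfl⟩
  have k1 : p.isoOpensRange.hom ≫ Y.homOfLE hW'V = χ := by
    rw [← cancel_mono V.ι, Category.assoc, Scheme.homOfLE_ι, h1]
    exact Scheme.Hom.isoOpensRange_hom_ι p
  have k2 : Y.homOfLE hW'V = p.isoOpensRange.inv ≫ χ := by
    rw [Iso.eq_inv_comp]; exact k1
  let χ' : W'.toScheme ⟶ U.toScheme := p.isoOpensRange.inv ≫ X.homOfLE hWU
  have k3 : χ' ≫ U.ι = Y.homOfLE hW'V ≫ ψ₀ := by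
    rw [k2, Category.assoc, Category.assoc, h2, Scheme.homOfLE_ι]
  have k4 : χ' ≫ φ₀ = W'.ι := by
    rw [Category.assoc, ← hp]
    exact Scheme.Hom.isoOpensRange_inv_comp p
  refine ⟨himm, ?_, W', hW'V, χ', hW'd, k3, k4⟩
  have := max_le V hVdense ψ₀ hψ₀over hVmax ⟨φ₀.opensRange, hV1d, φ₀.isoOpensRange.inv ≫ U.ι⟩
    ⟨W', hW'd, hW'1, hW'V, ?_⟩
  · exact this
  · change Y.homOfLE hW'1 ≫ φ₀.isoOpensRange.inv ≫ U.ι = Y.homOfLE hW'V ≫ ψ₀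
    rw [← k3, ← Category.assoc]
    congr 1
    rw [← cancel_mono φ₀, k4, Category.assoc, Scheme.Hom.isoOpensRange_inv_comp, Scheme.homOfLE_ι]

theorem final (n : ℕ) (X Y : Scheme.{0})
    [X.Over (Spec ℂRing)] [Y.Over (Spec ℂRing)]
    [IsIntegral X] [IsIntegral Y]
    [SmoothOfRelativeDimension n (X ↘ Spec ℂRing)]
    [SmoothOfRelativeDimension n (Y ↘ Spec ℂRing)]
    (hXproj : IsProjectiveComplexVariety X) (hYproj : IsProjectiveComplexVariety Y)
    (hKX : Nonempty (GaugeForm ℂRing X n)) (hKY : Nonempty (GaugeForm ℂRing Y n))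
    (U : X.Opens) (hUdense : Dense (U : Set X))
    (φ₀ : U.toScheme ⟶ Y)
    (hφ₀over : φ₀ ≫ (Y ↘ Spec ℂRing) = U.ι ≫ (X ↘ Spec ℂRing))
    (hUmax : ∀ (U' : X.Opens) (ψ : U'.toScheme ⟶ Y),
      ψ ≫ (Y ↘ Spec ℂRing) = U'.ι ≫ (X ↘ Spec ℂRing) →
      ∀ hle : U ≤ U', X.homOfLE hle ≫ ψ = φ₀ → U' ≤ U)
    (V : Y.Opens) (hVdense : Dense (V : Set Y))
    (ψ₀ : V.toScheme ⟶ X)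
    (hψ₀over : ψ₀ ≫ (X ↘ Spec ℂRing) = V.ι ≫ (Y ↘ Spec ℂRing))
    (hVmax : ∀ (V' : Y.Opens) (χ : V'.toScheme ⟶ X),
      χ ≫ (X ↘ Spec ℂRing) = V'.ι ≫ (Y ↘ Spec ℂRing) →
      ∀ hle : V ≤ V', Y.homOfLE hle ≫ χ = ψ₀ → V' ≤ V)
    (hbir : ∃ (W : X.Opens) (hWU : W ≤ U) (χ : W.toScheme ⟶ V.toScheme),
      Dense (W : Set X) ∧ χ ≫ V.ι = X.homOfLE hWU ≫ φ₀ ∧ χ ≫ ψ₀ = W.ι) :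
    Etale φ₀ ∧ IsOpenImmersion φ₀ ∧ Set.range φ₀.base = (V : Set Y) := by
  obtain ⟨GX⟩ := hKX
  obtain ⟨GY⟩ := hKY
  obtain ⟨h1, h2, hb⟩ := half n X Y hXproj hYproj GX GY U hUdense φ₀ hφ₀over hUmax V hVdense ψ₀
    hψ₀over hVmax hbir
  obtain ⟨-, h3, -⟩ := half n Y X hYproj hXproj GY GX V hVdense ψ₀ hψ₀over hVmax U hUdense φ₀
    hφ₀over hUmax hb
  refine ⟨inferInstance, h1, Set.Subset.antisymm h2 ?_⟩
  obtain ⟨W, hWV, χ, hWd, h4, h5⟩ := hb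
  have hYs := proj_sep Y hYproj
  let l : V.toScheme ⟶ U.toScheme := IsOpenImmersion.lift U.ι ψ₀ (by rw [Scheme.Opens.range_ι]; exact h3)
  have hl : l ≫ U.ι = ψ₀ := IsOpenImmersion.lift_fac _ _ _
  have hdom : IsDominant (Y.homOfLE hWV) := by
    obtain ⟨w, hw⟩ := hWd.nonempty
    have : Nonempty V := ⟨⟨w, hWV hw⟩⟩
    have hirr : IsIntegral V.toScheme := inferInstance
    constructor
    exact (Y.homOfLE hWV).isOpenEmbedding.isOpen_range.dense ⟨_, ⟨⟨w, hw⟩, rfl⟩⟩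
  have hfin : l ≫ φ₀ = V.ι := by
    apply ext_of_isDominant (Y.homOfLE hWV)
    rw [Scheme.homOfLE_ι, ← h5, ← Category.assoc]
    congr 1
    rw [← cancel_mono U.ι, h4, Category.assoc, hl]
  intro v hv
  refine ⟨l ⟨v, hv⟩, ?_⟩
  exact (Scheme.Hom.comp_apply l φ₀ _).symm.trans (congrArg (fun g : V.toScheme ⟶ Y => g ⟨v, hv⟩) hfin)
end BG

theorem maximal_extension_of_birational_map_is_etale_open_immersion
    (n : ℕ) (X Y : Scheme.{0})
    [X.Over (Spec ℂRing)] [Y.Over (Spec ℂRing)]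
    [IsIntegral X] [IsIntegral Y]
    [SmoothOfRelativeDimension n (X ↘ Spec ℂRing)]
    [SmoothOfRelativeDimension n (Y ↘ Spec ℂRing)]
    (hXproj : IsProjectiveComplexVariety X) (hYproj : IsProjectiveComplexVariety Y)
    (hKX : Nonempty (GaugeForm ℂRing X n)) (hKY : Nonempty (GaugeForm ℂRing Y n))
    -- φ₀ : U → Y is the extension of the birational map φ to its maximal
    -- domain of definition U, a dense open subset of X:
    (U : X.Opens) (hUdense : Dense (U : Set X))
    (φ₀ : U.toScheme ⟶ Y)
    (hφ₀over : φ₀ ≫ (Y ↘ Spec ℂRing) = U.ι ≫ (X ↘ Spec ℂRing))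
    (hUmax : ∀ (U' : X.Opens) (ψ : U'.toScheme ⟶ Y),
      ψ ≫ (Y ↘ Spec ℂRing) = U'.ι ≫ (X ↘ Spec ℂRing) →
      ∀ hle : U ≤ U', X.homOfLE hle ≫ ψ = φ₀ → U' ≤ U)
    -- ψ₀ : V → X is the extension of the inverse rational map φ⁻¹ to its
    -- maximal domain of definition V, a dense open subset of Y:
    (V : Y.Opens) (hVdense : Dense (V : Set Y))
    (ψ₀ : V.toScheme ⟶ X)
    (hψ₀over : ψ₀ ≫ (X ↘ Spec ℂRing) = V.ι ≫ (Y ↘ Spec ℂRing))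
    (hVmax : ∀ (V' : Y.Opens) (χ : V'.toScheme ⟶ X),
      χ ≫ (X ↘ Spec ℂRing) = V'.ι ≫ (Y ↘ Spec ℂRing) →
      ∀ hle : V ≤ V', Y.homOfLE hle ≫ χ = ψ₀ → V' ≤ V)
    -- φ₀ and ψ₀ are mutually inverse birational maps: on a dense open subset
    -- W ⊆ U, the map φ₀ lands in V and ψ₀ ∘ φ₀ is the inclusion of W in X:
    (hbir : ∃ (W : X.Opens) (hWU : W ≤ U) (χ : W.toScheme ⟶ V.toScheme),
      Dense (W : Set X) ∧ χ ≫ V.ι = X.homOfLE hWU ≫ φ₀ ∧ χ ≫ ψ₀ = W.ι) :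
    IsEtale φ₀ ∧ IsOpenImmersion φ₀ ∧ Set.range φ₀.base = (V : Set Y) := by
  exact BG.final n X Y hXproj hYproj hKX hKY U hUdense φ₀ hφ₀over hUmax V hVdense ψ₀ hψ₀over
    hVmax hbir
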